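/- For every integer m ≥ 1, lim_{y→∞} T(y; m) = (6B/(π²ψ(m))) ∑_{j ≥ 1} log(1 + 1/j) ∑_{d ≤ j} ∑_{t ≤ j} α(dtm)·μ(d)·μ(t)/(ψ_m(d)·ψ_m(t)), and there is a constant C > 0 with |lim_{y→∞} T(y; m)| ≤ C/√ψ(m) for all m ≥ 1. -/

import Mathlib

open Finset MeasureTheory Filter

/-- `M(n, z) := ∑_{d ∣ n, d ≤ z} μ(d)`. -/
noncomputable def mobM (n : ℕ) (z : ℝ) : ℤ :=
  ∑ d ∈ n.divisors.filter (fun d : ℕ => (d : ℝ) ≤ z), ArithmeticFunction.moebius d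

/-- `S(x, z) := ∑_{n ≤ x} M(n, z)²`. -/
noncomputable def Ssum (x z : ℝ) : ℝ :=
  ∑ n ∈ Finset.Icc 1 ⌊x⌋₊, ((mobM n z : ℝ)) ^ 2

/-- `S(z) := ∑_{m, n ≤ z} μ(m) μ(n) / [m, n]`. -/
noncomputable def Sz (z : ℝ) : ℝ :=
  ∑ m ∈ Finset.Icc 1 ⌊z⌋₊, ∑ n ∈ Finset.Icc 1 ⌊z⌋₊,
    ((ArithmeticFunction.moebius m : ℝ) * (ArithmeticFunction.moebius n : ℝ)) / (Nat.lcm m n : ℝ)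

/-- `f(n; iτ) := ∏_{p ∣ n} |1 - p^{-iτ}|²`. -/
noncomputable def fI (n : ℕ) (τ : ℝ) : ℝ :=
  ∏ p ∈ n.primeFactors, ‖(1 : ℂ) - (p : ℂ) ^ (-(τ * Complex.I))‖ ^ 2

/-- `f(n; s) := ∏_{p ∣ n} |1 - p^{-s}|²` for complex `s`. -/
noncomputable def fC (n : ℕ) (s : ℂ) : ℝ :=
  ∏ p ∈ n.primeFactors, ‖(1 : ℂ) - (p : ℂ) ^ (-s)‖ ^ 2

/-- The constant `L`. -/
noncomputable def Lconst : ℝ :=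
  (1 / (2 * Real.pi)) *
    ∫ τ : ℝ,
      (∏' p : Nat.Primes,
        (1 - 1 / ((p : ℕ) : ℝ)) * (1 + (fI (p : ℕ) τ - 1) / ((p : ℕ) : ℝ))) / τ ^ 2

/-- `𝓛(y) := exp{(log y)^{3/5} / (log log y)^{1/5}}`. -/
noncomputable def curlyL (y : ℝ) : ℝ :=
  Real.exp ((Real.log y) ^ ((3 : ℝ) / 5) / (Real.log (Real.log y)) ^ ((1 : ℝ) / 5))

/-- `ψ(n) := ∏_{p ∣ n} (p + 1)`. -/
def psi (n : ℕ) : ℕ := ∏ p ∈ n.primeFactors, (p + 1)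

/-- `ψ_m(n) := ∏_{p ∣ n, p ∤ m} (p + 1)`. -/
def psiM (m n : ℕ) : ℕ := ∏ p ∈ n.primeFactors.filter (fun p : ℕ => ¬ p ∣ m), (p + 1)

/-- `r(n) := ∏_{p ∣ n} (1 + 2/√p)`. -/
noncomputable def rfun (n : ℕ) : ℝ := ∏ p ∈ n.primeFactors, (1 + 2 / Real.sqrt p)

/-- `k(n)`, the squarefree kernel of `n`. -/
def ker (n : ℕ) : ℕ := ∏ p ∈ n.primeFactors, p

/-- `T(y; m) := (6/π²) ∑_{d, t ≤ y} μ(d) μ(t) / ψ([d, t, m])`. -/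
noncomputable def T (y : ℝ) (m : ℕ) : ℝ :=
  (6 / Real.pi ^ 2) *
    ∑ d ∈ Finset.Icc 1 ⌊y⌋₊, ∑ t ∈ Finset.Icc 1 ⌊y⌋₊,
      ((ArithmeticFunction.moebius d : ℝ) * (ArithmeticFunction.moebius t : ℝ)) /
        (psi (Nat.lcm (Nat.lcm d t) m) : ℝ)

/-- The constant `L(m)`. -/
noncomputable def Lm (m : ℕ) : ℝ :=
  ((Nat.totient m : ℝ) ^ 2 / (2 * Real.pi * (m : ℝ) ^ 2 * (ker m : ℝ))) *
    ∫ τ : ℝ,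
      (fI m τ *
        ∏' p : {p : Nat.Primes // ¬ ((p : ℕ) ∣ m)},
          (1 - 1 / ((p.1 : ℕ) : ℝ)) ^ 2 * (1 + fI (p.1 : ℕ) τ / ((p.1 : ℕ) : ℝ))) / τ ^ 2

/-- `B := ∏_p (1 - (3p + 1)/(p (p + 1)²))`. -/
noncomputable def Bconst : ℝ :=
  ∏' p : Nat.Primes,
    (1 - (3 * ((p : ℕ) : ℝ) + 1) / (((p : ℕ) : ℝ) * (((p : ℕ) : ℝ) + 1) ^ 2))

/-- `α(n) := ∏_{p ∣ n} (1 - p/(p² + 3p + 1))`. -/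
noncomputable def alpha (n : ℕ) : ℝ :=
  ∏ p ∈ n.primeFactors, (1 - (p : ℝ) / ((p : ℝ) ^ 2 + 3 * (p : ℝ) + 1))

/-- The error made when `(n + 1) ^ (-s)` is replaced by `∫ x in n + 1..n + 2, x ^ (-s)`. -/
noncomputable def zetaErr (n : ℕ) (s : ℂ) : ℂ :=
  ((n + 1 : ℝ) : ℂ) ^ (-s) -
    (((n + 1 : ℝ) : ℂ) ^ (1 - s) - ((n + 2 : ℝ) : ℂ) ^ (1 - s)) / (s - 1)

lemma norm_cpow_sub_cpow_le {a x : ℝ} (ha : 0 < a) (hax : a ≤ x) (hx : x ≤ a + 1) {s : ℂ}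
    (hs : 0 < s.re) :
    ‖(a : ℂ) ^ (-s) - (x : ℂ) ^ (-s)‖ ≤ ‖s‖ * a ^ (-s.re - 1) := by
  have h := (convex_Icc a x).norm_image_sub_le_of_norm_hasDerivWithin_le
    (f := fun u : ℝ => (u : ℂ) ^ (-s)) (f' := fun u : ℝ => -s * (u : ℂ) ^ (-s - 1))
    (C := ‖s‖ * a ^ (-s.re - 1)) (x := x) (y := a) ?_ ?_ ?_ ?_
  · refine h.trans ?_
    rw [Real.norm_eq_abs, abs_sub_comm, abs_of_nonneg (by linarith)]
    have : 0 ≤ ‖s‖ * a ^ (-s.re - 1) := by positivity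
    nlinarith
  · intro u hu
    have hu0 : 0 < u := lt_of_lt_of_le ha hu.1
    have hne : -s ≠ 0 := by
      intro h0
      have : s = 0 := neg_eq_zero.mp h0
      simp [this] at hs
    exact (hasDerivAt_ofReal_cpow_const hu0.ne' hne).hasDerivWithinAt
  · intro u hu
    have hu0 : 0 < u := lt_of_lt_of_le ha hu.1
    rw [norm_mul, norm_neg, Complex.norm_cpow_eq_rpow_re_of_pos hu0]
    simp only [Complex.sub_re, Complex.neg_re, Complex.one_re]
    gcongr ?_ * ?_
    exact Real.rpow_le_rpow_of_nonpos ha hu.1 (by linarith)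
  · exact ⟨hax, le_rfl⟩
  · exact ⟨le_rfl, hax⟩

lemma norm_cpow_sub_cpow_le_two {a x : ℝ} (ha : 0 < a) (hax : a ≤ x) {s : ℂ} (hs : 0 < s.re) :
    ‖(a : ℂ) ^ (-s) - (x : ℂ) ^ (-s)‖ ≤ 2 * a ^ (-s.re) := by
  refine (norm_sub_le _ _).trans ?_
  rw [Complex.norm_cpow_eq_rpow_re_of_pos ha,
    Complex.norm_cpow_eq_rpow_re_of_pos (lt_of_lt_of_le ha hax)]
  have := Real.rpow_le_rpow_of_nonpos ha hax (z := (-s).re) (by simp [hs.le])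
  simp only [Complex.neg_re] at *
  linarith

lemma norm_zetaErr_le_of_bound (n : ℕ) {s : ℂ} (hs1 : s ≠ 1) {C : ℝ}
    (hC : ∀ x : ℝ, (n + 1 : ℝ) ≤ x → x ≤ n + 2 →
      ‖((n + 1 : ℝ) : ℂ) ^ (-s) - (x : ℂ) ^ (-s)‖ ≤ C) : ‖zetaErr n s‖ ≤ C := by
  have hn : (0 : ℝ) < n + 1 := by positivity
  have h1s : 1 - s ≠ 0 := sub_ne_zero.mpr hs1.symm
  have h := (convex_Icc (n + 1 : ℝ) (n + 2)).norm_image_sub_le_of_norm_hasDerivWithin_le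
    (f := fun u : ℝ => ((n + 1 : ℝ) : ℂ) ^ (-s) * u - (u : ℂ) ^ (1 - s) / (1 - s))
    (f' := fun u : ℝ => ((n + 1 : ℝ) : ℂ) ^ (-s) - (u : ℂ) ^ (-s))
    (C := C) (x := (n + 1 : ℝ)) (y := n + 2) ?_ ?_ ?_ ?_
  · rw [show ‖(n + 2 : ℝ) - (n + 1)‖ = 1 by rw [show (n + 2 : ℝ) - (n + 1) = 1 by ring]; simp,
      mul_one] at h
    have h1s' : s - 1 ≠ 0 := sub_ne_zero.mpr hs1
    have e : zetaErr n s = ((n + 1 : ℝ) : ℂ) ^ (-s) * ((n + 2 : ℝ) : ℂ) -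
        ((n + 2 : ℝ) : ℂ) ^ (1 - s) / (1 - s) - (((n + 1 : ℝ) : ℂ) ^ (-s) * ((n + 1 : ℝ) : ℂ) -
        ((n + 1 : ℝ) : ℂ) ^ (1 - s) / (1 - s)) := by
      have e1 : ∀ z : ℂ, z / (1 - s) = -(z / (s - 1)) := fun z => by
        rw [← div_neg, neg_sub]
      simp only [zetaErr, e1]
      push_cast
      ring
    rw [e]
    exact h
  · intro u hu
    have hu0 : 0 < u := lt_of_lt_of_le hn hu.1
    have h1 := hasDerivAt_ofReal_cpow_const hu0.ne' h1s
    have h2 : HasDerivAt (fun u : ℝ => ((n + 1 : ℝ) : ℂ) ^ (-s) * u)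
        (((n + 1 : ℝ) : ℂ) ^ (-s) * 1) u :=
      (Complex.ofRealCLM.hasDerivAt (x := u)).const_mul _
    have h3 := (h2.fun_sub (h1.div_const (1 - s))).hasDerivWithinAt
      (s := Set.Icc (n + 1 : ℝ) (n + 2))
    rwa [mul_one, show 1 - s - 1 = -s by ring, mul_div_cancel_left₀ _ h1s] at h3
  · intro u hu
    exact hC u hu.1 hu.2
  · exact ⟨le_rfl, by linarith⟩
  · exact ⟨by linarith, le_rfl⟩

lemma norm_zetaErr_le (n : ℕ) {s : ℂ} (hs1 : s ≠ 1) (hs : 71 / 72 ≤ s.re) :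
    ‖zetaErr n s‖ ≤ 2 * ‖s‖ ^ (1 / 36 : ℝ) * (n + 1 : ℝ) ^ (-(73 / 72) : ℝ) := by
  have hn : (0 : ℝ) < n + 1 := by positivity
  have hs0 : 0 < s.re := by linarith
  set b := ‖zetaErr n s‖ with hb
  have h1 : b ≤ ‖s‖ * (n + 1 : ℝ) ^ (-s.re - 1) :=
    norm_zetaErr_le_of_bound n hs1 fun x hx hx2 => norm_cpow_sub_cpow_le hn hx (by linarith) hs0
  have h2 : b ≤ 2 * (n + 1 : ℝ) ^ (-s.re) :=
    norm_zetaErr_le_of_bound n hs1 fun x hx hx2 => norm_cpow_sub_cpow_le_two hn hx hs0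
  have hb0 : 0 ≤ b := norm_nonneg _
  calc b = b ^ (1 / 36 : ℝ) * b ^ (35 / 36 : ℝ) := by
        rw [← Real.rpow_add' hb0 (by norm_num)]; norm_num
    _ ≤ (‖s‖ * (n + 1 : ℝ) ^ (-s.re - 1)) ^ (1 / 36 : ℝ) *
        (2 * (n + 1 : ℝ) ^ (-s.re)) ^ (35 / 36 : ℝ) := by gcongr
    _ = ‖s‖ ^ (1 / 36 : ℝ) * (2 : ℝ) ^ (35 / 36 : ℝ) *
        (n + 1 : ℝ) ^ ((-s.re - 1) * (1 / 36) + -s.re * (35 / 36)) := by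
        rw [Real.mul_rpow (by positivity) (by positivity),
          Real.mul_rpow (by positivity) (by positivity), ← Real.rpow_mul hn.le,
          ← Real.rpow_mul hn.le, Real.rpow_add hn]
        ring
    _ ≤ ‖s‖ ^ (1 / 36 : ℝ) * (2 : ℝ) ^ (1 : ℝ) * (n + 1 : ℝ) ^ (-(73 / 72) : ℝ) := by
        gcongr ?_ * ?_ * ?_
        · exact Real.rpow_le_rpow_of_exponent_le (by norm_num) (by norm_num)
        · exact Real.rpow_le_rpow_of_exponent_le (by linarith [n.cast_nonneg (α := ℝ)])
            (by linarith)
    _ = _ := by rw [Real.rpow_one]; ring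

lemma summable_zetaErr_bound : Summable fun n : ℕ => (n + 1 : ℝ) ^ (-(73 / 72) : ℝ) := by
  have := (summable_nat_add_iff 1).mpr (Real.summable_nat_rpow.mpr
    (by norm_num : (-(73 / 72) : ℝ) < -1))
  simpa using this

lemma hasSum_zetaErr {s : ℂ} (hs : 1 < s.re) :
    HasSum (fun n => zetaErr n s) (riemannZeta s - 1 / (s - 1)) := by
  have hs1 : s ≠ 1 := by rintro rfl; simp at hs
  have hz : HasSum (fun n : ℕ => ((n + 1 : ℝ) : ℂ) ^ (-s)) (riemannZeta s) := by
    have h := (summable_nat_add_iff 1).mpr (Complex.summable_one_div_nat_cpow.mpr hs)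
    rw [zeta_eq_tsum_one_div_nat_add_one_cpow hs]
    have e : ∀ n : ℕ, ((n + 1 : ℝ) : ℂ) ^ (-s) = 1 / ((n + 1 : ℕ) : ℂ) ^ s := fun n => by
      rw [Complex.cpow_neg]; push_cast; simp
    simp_rw [e]
    simpa using h.hasSum
  have hsum : Summable fun n => zetaErr n s := by
    refine .of_norm_bounded (summable_zetaErr_bound.mul_left (2 * ‖s‖ ^ (1 / 36 : ℝ)))
      fun n => norm_zetaErr_le n hs1 (by linarith)
  have htel : Tendsto (fun N : ℕ => ∑ n ∈ range N,
      (((n + 1 : ℝ) : ℂ) ^ (1 - s) - ((n + 2 : ℝ) : ℂ) ^ (1 - s)) / (s - 1)) atTop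
      (nhds (1 / (s - 1))) := by
    have h1 : ∀ N : ℕ, ∑ n ∈ range N,
        (((n + 1 : ℝ) : ℂ) ^ (1 - s) - ((n + 2 : ℝ) : ℂ) ^ (1 - s)) / (s - 1) =
        (1 - ((N + 1 : ℝ) : ℂ) ^ (1 - s)) / (s - 1) := by
      intro N
      rw [← Finset.sum_div]
      have h2 := Finset.sum_range_sub' (fun n : ℕ => ((n + 1 : ℝ) : ℂ) ^ (1 - s)) N
      have e : ∀ n : ℕ, ((n + 1 : ℕ) + 1 : ℝ) = (n : ℝ) + 2 := fun n => by push_cast; ring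
      simp only [e] at h2
      rw [h2]
      simp
    simp_rw [h1]
    have h3 : Tendsto (fun N : ℕ => ((N + 1 : ℝ) : ℂ) ^ (1 - s)) atTop (nhds 0) := by
      rw [tendsto_zero_iff_norm_tendsto_zero]
      have h4 : ∀ N : ℕ, ‖((N + 1 : ℝ) : ℂ) ^ (1 - s)‖ = (N + 1 : ℝ) ^ (-(s.re - 1)) := by
        intro N
        rw [Complex.norm_cpow_eq_rpow_re_of_pos (by positivity)]
        simp
      simp_rw [h4]
      exact (tendsto_rpow_neg_atTop (by linarith)).comp
        (tendsto_atTop_add_const_right _ _ tendsto_natCast_atTop_atTop)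
    simpa using ((tendsto_const_nhds (x := (1 : ℂ))).sub h3).div_const (s - 1)
  have hlim := hz.tendsto_sum_nat.sub htel
  simp_rw [← Finset.sum_sub_distrib] at hlim
  have : (∑' n, zetaErr n s) = riemannZeta s - 1 / (s - 1) :=
    tendsto_nhds_unique hsum.hasSum.tendsto_sum_nat hlim
  rw [← this]
  exact hsum.hasSum

lemma norm_tsum_zetaErr_le : ∃ C > (0 : ℝ), ∀ s : ℂ, s ≠ 1 → 71 / 72 ≤ s.re →
    ‖∑' n, zetaErr n s‖ ≤ C * ‖s‖ ^ (1 / 36 : ℝ) := by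
  have hS := summable_zetaErr_bound
  have hpos : 0 < ∑' n : ℕ, (n + 1 : ℝ) ^ (-(73 / 72) : ℝ) :=
    hS.tsum_pos (fun n => by positivity) 0 (by norm_num)
  refine ⟨2 * ∑' n : ℕ, (n + 1 : ℝ) ^ (-(73 / 72) : ℝ), by positivity, fun s hs1 hs => ?_⟩
  have h := tsum_of_norm_bounded (hS.mul_left (2 * ‖s‖ ^ (1 / 36 : ℝ))).hasSum
    fun n => norm_zetaErr_le n hs1 hs
  rw [tsum_mul_left] at h
  linarith

lemma differentiableAt_zetaErr (n : ℕ) {s : ℂ} (hs1 : s ≠ 1) :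
    DifferentiableAt ℂ (zetaErr n) s := by
  have h1 : ((n + 1 : ℝ) : ℂ) ≠ 0 := by exact_mod_cast n.succ_ne_zero
  have h2 : ((n + 2 : ℝ) : ℂ) ≠ 0 := by exact_mod_cast (n + 1).succ_ne_zero
  have h3 : s - 1 ≠ 0 := sub_ne_zero.mpr hs1
  unfold zetaErr
  refine .sub ?_ (.div (.sub ?_ ?_) (by fun_prop) h3)
  · exact (differentiableAt_id.neg).const_cpow (Or.inl h1)
  · exact ((differentiableAt_const _).sub differentiableAt_id).const_cpow (Or.inl h1)
  · exact ((differentiableAt_const _).sub differentiableAt_id).const_cpow (Or.inl h2)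

lemma differentiableOn_tsum_zetaErr (c : ℂ) {r : ℝ} (h1 : (1 : ℂ) ∉ Metric.ball c r)
    (hr : ∀ s ∈ Metric.ball c r, 71 / 72 ≤ s.re) :
    DifferentiableOn ℂ (fun s => ∑' n, zetaErr n s) (Metric.ball c r) := by
  refine Complex.differentiableOn_tsum_of_summable_norm
    (u := fun n : ℕ => 2 * (‖c‖ + r) ^ (1 / 36 : ℝ) * (n + 1 : ℝ) ^ (-(73 / 72) : ℝ))
    (summable_zetaErr_bound.mul_left _) ?_ Metric.isOpen_ball ?_
  · intro n s hs
    exact (differentiableAt_zetaErr n (ne_of_mem_of_not_mem hs h1)).differentiableWithinAt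
  · intro n s hs
    refine (norm_zetaErr_le n (ne_of_mem_of_not_mem hs h1) (hr s hs)).trans ?_
    gcongr
    have := norm_le_norm_add_norm_sub' s c
    have h2 : ‖s - c‖ < r := mem_ball_iff_norm.mp hs
    linarith

lemma norm_riemannZeta_le : ∃ C > (0 : ℝ), ∀ s : ℂ, 1 < s.re → s.re ≤ 2 → 1 ≤ |s.im| →
    ‖riemannZeta s‖ ≤ C * |s.im| ^ (1 / 36 : ℝ) ∧
      ‖deriv riemannZeta s‖ ≤ C * |s.im| ^ (1 / 36 : ℝ) := by
  obtain ⟨C, hC, hE⟩ := norm_tsum_zetaErr_le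
  refine ⟨200 * (C * 6) + 1, by positivity, fun s hs1 hs2 him => ?_⟩
  have hns : ‖s‖ ≤ 3 * |s.im| := by
    have := Complex.norm_le_abs_re_add_abs_im s
    rw [abs_of_pos (by linarith : 0 < s.re)] at this
    linarith
  have hs1' : s ≠ 1 := by rintro rfl; simp at hs1
  have hsub : 1 ≤ ‖s - 1‖ := him.trans (by simpa using Complex.abs_im_le_norm (s - 1))
  have hinv : ‖1 / (s - 1)‖ ≤ 1 := by
    rw [norm_div, norm_one]; exact div_le_one_of_le₀ hsub (norm_nonneg _)
  have hp1 : 1 ≤ |s.im| ^ (1 / 36 : ℝ) := Real.one_le_rpow him (by norm_num)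
  have h6 : (6 : ℝ) ^ (1 / 36 : ℝ) ≤ 6 := by
    conv_rhs => rw [← Real.rpow_one 6]
    exact Real.rpow_le_rpow_of_exponent_le (by norm_num) (by norm_num)
  have hEb : ∀ z : ℂ, z ∈ Metric.closedBall s (1 / 100) → z ≠ 1 ∧ 71 / 72 ≤ z.re ∧
      ‖∑' n, zetaErr n z‖ ≤ C * 6 * |s.im| ^ (1 / 36 : ℝ) := by
    intro z hz
    have hz' : ‖z - s‖ ≤ 1 / 100 := mem_closedBall_iff_norm.mp hz
    have him' := (Complex.abs_im_le_norm (z - s)).trans hz'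
    have hre' := (Complex.abs_re_le_norm (z - s)).trans hz'
    rw [Complex.sub_im] at him'
    rw [Complex.sub_re] at hre'
    have hz1 : z ≠ 1 := by
      rintro rfl
      simp only [Complex.one_im, zero_sub, abs_neg] at him'
      linarith
    have hzre : 71 / 72 ≤ z.re := by linarith [(abs_le.mp hre').1]
    refine ⟨hz1, hzre, (hE z hz1 hzre).trans ?_⟩
    have hnz : ‖z‖ ≤ 6 * |s.im| := by
      have := norm_le_norm_add_norm_sub' z s
      linarith
    calc C * ‖z‖ ^ (1 / 36 : ℝ) ≤ C * (6 * |s.im|) ^ (1 / 36 : ℝ) := by gcongr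
      _ = C * (6 ^ (1 / 36 : ℝ) * |s.im| ^ (1 / 36 : ℝ)) := by
        rw [Real.mul_rpow (by norm_num) (abs_nonneg _)]
      _ ≤ C * (6 * |s.im| ^ (1 / 36 : ℝ)) := by gcongr
      _ = _ := by ring
  have hball : DifferentiableOn ℂ (fun s => ∑' n, zetaErr n s) (Metric.ball s (1 / 100)) :=
    differentiableOn_tsum_zetaErr s
      (fun h => (hEb 1 (Metric.ball_subset_closedBall h)).1 rfl)
      fun z hz => (hEb z (Metric.ball_subset_closedBall hz)).2.1
  have heq : riemannZeta =ᶠ[nhds s] fun z => (∑' n, zetaErr n z) + 1 / (z - 1) := by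
    filter_upwards [(isOpen_lt continuous_const Complex.continuous_re).mem_nhds hs1] with z hz
    rw [(hasSum_zetaErr hz).tsum_eq]
    ring
  constructor
  · rw [heq.eq_of_nhds]
    refine (norm_add_le _ _).trans ?_
    have := (hEb s (Metric.mem_closedBall_self (by norm_num))).2.2
    nlinarith
  · have hd : DifferentiableAt ℂ (fun z => ∑' n, zetaErr n z) s :=
      hball.differentiableAt (Metric.ball_mem_nhds _ (by norm_num))
    have hne : s - 1 ≠ 0 := sub_ne_zero.mpr hs1'
    have hd2 : HasDerivAt (fun z : ℂ => 1 / (z - 1)) (-1 / (s - 1) ^ 2) s := by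
      simpa using ((hasDerivAt_id s).sub_const 1).fun_inv hne
    have hder := (hd.hasDerivAt.fun_add hd2).deriv
    rw [heq.deriv_eq, hder]
    refine (norm_add_le _ _).trans ?_
    have h1 : ‖deriv (fun z => ∑' n, zetaErr n z) s‖ ≤
        C * 6 * |s.im| ^ (1 / 36 : ℝ) / (1 / 200) := by
      refine Complex.norm_deriv_le_of_forall_mem_sphere_norm_le (by norm_num) ?_ ?_
      · refine (hball.mono ?_).diffContOnCl
        rw [closure_ball _ (by norm_num)]
        exact Metric.closedBall_subset_ball (by norm_num)
      · intro z hz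
        refine (hEb z ?_).2.2
        exact Metric.closedBall_subset_closedBall (by norm_num) (Metric.sphere_subset_closedBall hz)
    have h2 : ‖-1 / (s - 1) ^ 2‖ ≤ 1 := by
      rw [norm_div, norm_neg, norm_one, norm_pow]
      exact div_le_one_of_le₀ (one_le_pow₀ hsub) (by positivity)
    nlinarith

lemma riemannZeta₁_ne_zero {s : ℂ} (hs : 1 ≤ s.re) : riemannZeta₁ s ≠ 0 := by
  rcases eq_or_ne s 1 with rfl | h1
  · simp
  · intro h
    refine riemannZeta_ne_zero_of_one_le_re hs ?_
    rw [riemannZeta_eq_inv_sub_mul h1, h, mul_zero]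

lemma riemannZeta₁_eq {s : ℂ} (hs : s ≠ 1) : riemannZeta₁ s = (s - 1) * riemannZeta s := by
  rw [riemannZeta_eq_inv_sub_mul hs, mul_inv_cancel_left₀ (sub_ne_zero.mpr hs)]

lemma deriv_riemannZeta₁_eq {s : ℂ} (hs : s ≠ 1) :
    deriv riemannZeta₁ s = riemannZeta s + (s - 1) * deriv riemannZeta s := by
  have h := sub_ne_zero.mpr hs
  rw [deriv_riemannZeta_eq_neg_inv_sub_sq_mul_add hs, riemannZeta_eq_inv_sub_mul hs]
  field_simp
  ring

lemma norm_riemannZeta_one_add_le : ∃ K > (0 : ℝ), ∀ x : ℝ, 0 < x → x ≤ 1 →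
    ‖riemannZeta (1 + x)‖ ≤ K / x := by
  obtain ⟨K, hK⟩ := (isCompact_Icc (a := (0 : ℝ)) (b := 1)).exists_bound_of_continuousOn
    (f := fun x : ℝ => riemannZeta₁ (1 + x))
    (differentiable_riemannZeta₁.continuous.comp (by fun_prop)).continuousOn
  refine ⟨|K| + 1, by positivity, fun x hx hx1 => ?_⟩
  have hne : (1 + x : ℂ) ≠ 1 := by
    simpa using hx.ne'
  rw [riemannZeta_eq_inv_sub_mul hne, add_sub_cancel_left, norm_mul, norm_inv, Complex.norm_real,
    Real.norm_of_nonneg hx.le, div_eq_inv_mul]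
  gcongr
  have := hK x ⟨hx.le, hx1⟩
  linarith [le_abs_self K]

lemma one_le_norm_riemannZeta_product {x : ℝ} (hx : 0 < x) (y : ℝ) :
    1 ≤ ‖riemannZeta (1 + x)‖ ^ 3 * ‖riemannZeta (1 + x + Complex.I * y)‖ ^ 4 *
      ‖riemannZeta (1 + x + 2 * Complex.I * y)‖ := by
  have h := DirichletCharacter.norm_LFunction_product_ge_one (1 : DirichletCharacter ℂ 1) hx y
  rwa [DirichletCharacter.LFunctionTrivChar, one_pow, DirichletCharacter.LFunction_modOne_eq,
    norm_mul, norm_mul, norm_pow, norm_pow] at h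

lemma le_norm_riemannZeta_aux : ∃ c > (0 : ℝ), ∀ x y : ℝ, 0 < x → x ≤ 1 → 1 ≤ |y| →
    c * x ^ (3 / 4 : ℝ) * |y| ^ (-(1 / 144) : ℝ) ≤ ‖riemannZeta (1 + x + Complex.I * y)‖ := by
  obtain ⟨C, hC, hz⟩ := norm_riemannZeta_le
  obtain ⟨K, hK, hk⟩ := norm_riemannZeta_one_add_le
  refine ⟨((K ^ 3 * (C * 2))⁻¹) ^ (1 / 4 : ℝ), by positivity, fun x y hx hx1 hy => ?_⟩
  have hy0 : 0 < |y| := by linarith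
  have h1 := one_le_norm_riemannZeta_product hx y
  have h2 := (hz (1 + x + 2 * Complex.I * y) (by simpa using hx)
    (by simp; linarith) (by simp; linarith)).1
  have him : (1 + x + 2 * Complex.I * y : ℂ).im = 2 * y := by simp
  rw [him, abs_mul, abs_two, Real.mul_rpow (by norm_num) (abs_nonneg _)] at h2
  have h2' : (2 : ℝ) ^ (1 / 36 : ℝ) ≤ 2 := by
    conv_rhs => rw [← Real.rpow_one 2]
    exact Real.rpow_le_rpow_of_exponent_le (by norm_num) (by norm_num)
  have h3 : ‖riemannZeta (1 + x + 2 * Complex.I * y)‖ ≤ C * (2 * |y| ^ (1 / 36 : ℝ)) :=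
    h2.trans (by gcongr)
  set Z := ‖riemannZeta (1 + x + Complex.I * y)‖
  have hZ : 0 ≤ Z := norm_nonneg _
  have h4 : 1 ≤ (K / x) ^ 3 * Z ^ 4 * (C * (2 * |y| ^ (1 / 36 : ℝ))) := by
    refine h1.trans ?_
    gcongr
    exact hk x hx hx1
  have h5 : (K ^ 3 * (C * 2))⁻¹ * x ^ 3 * |y| ^ (-(1 / 36) : ℝ) ≤ Z ^ 4 := by
    rw [Real.rpow_neg hy0.le]
    have h6 : (K / x) ^ 3 * Z ^ 4 * (C * (2 * |y| ^ (1 / 36 : ℝ))) =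
      (K ^ 3 * (C * 2)) * |y| ^ (1 / 36 : ℝ) * Z ^ 4 / x ^ 3 := by ring
    rw [h6, le_div_iff₀ (by positivity), one_mul] at h4
    have hyp : 0 < |y| ^ (1 / 36 : ℝ) := by positivity
    rw [mul_assoc, inv_mul_le_iff₀ (by positivity), ← div_eq_mul_inv, div_le_iff₀ hyp]
    linarith
  have h7 := Real.rpow_le_rpow (by positivity) h5 (by norm_num : (0 : ℝ) ≤ 1 / 4)
  rw [← Real.rpow_natCast Z, ← Real.rpow_mul hZ, Real.mul_rpow (by positivity) (by positivity),
    Real.mul_rpow (by positivity) (by positivity), ← Real.rpow_natCast x, ← Real.rpow_mul hx.le,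
    ← Real.rpow_mul hy0.le] at h7
  norm_num at h7 ⊢
  exact h7

lemma le_norm_riemannZeta : ∃ c > (0 : ℝ), ∀ x y : ℝ, 0 < x → x ≤ 1 → 1 ≤ |y| →
    c * |y| ^ (-(1 / 9) : ℝ) ≤ ‖riemannZeta (1 + x + Complex.I * y)‖ := by
  obtain ⟨C, hC, hz⟩ := norm_riemannZeta_le
  obtain ⟨c, hc, hl⟩ := le_norm_riemannZeta_aux
  set κ := min 1 ((c / (2 * C)) ^ (4 : ℝ)) with hκ
  have hκ0 : 0 < κ := by positivity
  have hκ1 : κ ≤ 1 := min_le_left _ _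
  have hκ2 : C * κ ≤ c * κ ^ (3 / 4 : ℝ) / 2 := by
    have h1 : κ ^ (1 / 4 : ℝ) ≤ c / (2 * C) := by
      have := Real.rpow_le_rpow hκ0.le (min_le_right 1 ((c / (2 * C)) ^ (4 : ℝ)))
        (by norm_num : (0 : ℝ) ≤ 1 / 4)
      rwa [← Real.rpow_mul (by positivity), show (4 : ℝ) * (1 / 4) = 1 by norm_num,
        Real.rpow_one] at this
    have h2 : κ = κ ^ (3 / 4 : ℝ) * κ ^ (1 / 4 : ℝ) := by
      rw [← Real.rpow_add hκ0]; norm_num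
    calc C * κ = C * (κ ^ (3 / 4 : ℝ) * κ ^ (1 / 4 : ℝ)) := by rw [← h2]
      _ ≤ C * (κ ^ (3 / 4 : ℝ) * (c / (2 * C))) := by gcongr
      _ = _ := by field_simp
  refine ⟨c * κ ^ (3 / 4 : ℝ) / 2, by positivity, fun δ y hδ hδ1 hy => ?_⟩
  have hy0 : 0 < |y| := by linarith
  set x := κ * |y| ^ (-(5 / 36) : ℝ) with hx
  have hx0 : 0 < x := by positivity
  have hyle : |y| ^ (-(5 / 36) : ℝ) ≤ 1 := Real.rpow_le_one_of_one_le_of_nonpos hy (by norm_num)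
  have hx1 : x ≤ 1 := by
    have : 0 ≤ |y| ^ (-(5 / 36) : ℝ) := by positivity
    nlinarith
  have hxl : ∀ z, x ≤ z → c * κ ^ (3 / 4 : ℝ) * |y| ^ (-(1 / 9) : ℝ) ≤
      c * z ^ (3 / 4 : ℝ) * |y| ^ (-(1 / 144) : ℝ) := by
    intro z hxz
    calc c * κ ^ (3 / 4 : ℝ) * |y| ^ (-(1 / 9) : ℝ) =
        c * x ^ (3 / 4 : ℝ) * |y| ^ (-(1 / 144) : ℝ) := by
          rw [hx, Real.mul_rpow hκ0.le (by positivity), ← Real.rpow_mul hy0.le, mul_assoc,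
            mul_assoc, mul_assoc, ← Real.rpow_add hy0]
          norm_num
      _ ≤ _ := by gcongr
  have hpos : 0 < c * κ ^ (3 / 4 : ℝ) * |y| ^ (-(1 / 9) : ℝ) := by positivity
  rcases le_total x δ with h | h
  · have := (hxl δ h).trans (hl δ y hδ hδ1 hy)
    linarith
  · have h1 := (hxl x le_rfl).trans (hl x y hx0 hx1 hy)
    have h2 : ‖riemannZeta (1 + x + Complex.I * y) - riemannZeta (1 + δ + Complex.I * y)‖ ≤
        C * |y| ^ (1 / 36 : ℝ) * ‖(1 + x + Complex.I * y : ℂ) - (1 + δ + Complex.I * y)‖ := by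
      refine Convex.norm_image_sub_le_of_norm_deriv_le (𝕜 := ℂ)
        (s := {z : ℂ | 1 < z.re} ∩ {z : ℂ | z.re ≤ 2} ∩ ({z : ℂ | z.im ≤ y} ∩ {z : ℂ | y ≤ z.im}))
        ?_ ?_ ?_ ?_ ?_
      · rintro z ⟨⟨h1, -⟩, -⟩
        exact differentiableAt_riemannZeta (by rintro rfl; simp at h1)
      · rintro z ⟨⟨h1, h2⟩, h3, h4⟩
        have h5 : z.im = y := le_antisymm h3 h4
        have := (hz z h1 h2 (by rwa [h5])).2
        rwa [h5] at this
      · exact ((convex_halfSpace_re_gt 1).inter (convex_halfSpace_re_le 2)).inter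
          ((convex_halfSpace_im_le y).inter (convex_halfSpace_im_ge y))
      · simp; constructor <;> linarith
      · simp; constructor <;> linarith
    have h3 : ‖(1 + x + Complex.I * y : ℂ) - (1 + δ + Complex.I * y)‖ ≤ x := by
      rw [show (1 + x + Complex.I * y : ℂ) - (1 + δ + Complex.I * y) = ((x - δ : ℝ) : ℂ) by
        push_cast; ring, Complex.norm_real, Real.norm_of_nonneg (by linarith)]
      linarith
    have h4 : C * |y| ^ (1 / 36 : ℝ) * x = C * κ * |y| ^ (-(1 / 9) : ℝ) := by
      rw [hx, show C * |y| ^ (1 / 36 : ℝ) * (κ * |y| ^ (-(5 / 36) : ℝ)) =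
        C * κ * (|y| ^ (1 / 36 : ℝ) * |y| ^ (-(5 / 36) : ℝ)) by ring, ← Real.rpow_add hy0]
      norm_num
    have h5 : C * κ * |y| ^ (-(1 / 9) : ℝ) ≤ c * κ ^ (3 / 4 : ℝ) / 2 * |y| ^ (-(1 / 9) : ℝ) := by
      gcongr
    have h6 := h2.trans (mul_le_mul_of_nonneg_left h3 (by positivity))
    have h7 := norm_sub_norm_le (riemannZeta (1 + x + Complex.I * y))
      (riemannZeta (1 + δ + Complex.I * y))
    linarith

lemma norm_deriv_inv_riemannZeta₁_le : ∃ C > (0 : ℝ), ∀ δ t : ℝ, 0 < δ → δ ≤ 1 →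
    ‖deriv (fun s => (riemannZeta₁ (1 + s))⁻¹) (δ + Complex.I * t)‖ ≤
      C * (1 + |t|) ^ (-(3 / 4) : ℝ) := by
  have hd : ∀ δ t : ℝ, 0 ≤ δ → deriv (fun s => (riemannZeta₁ (1 + s))⁻¹) (δ + Complex.I * t) =
      -deriv riemannZeta₁ (1 + (δ + Complex.I * t)) /
        riemannZeta₁ (1 + (δ + Complex.I * t)) ^ 2 := by
    intro δ t hδ
    have h0 : riemannZeta₁ (1 + (δ + Complex.I * t)) ≠ 0 := riemannZeta₁_ne_zero (by simp [hδ])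
    have h1 := (differentiable_riemannZeta₁ (1 + (δ + Complex.I * t))).hasDerivAt
    exact ((h1.comp_const_add _ _).fun_inv h0).deriv
  obtain ⟨C, hC, hz⟩ := norm_riemannZeta_le
  obtain ⟨c, hc, hl⟩ := le_norm_riemannZeta
  have hcont : ContinuousOn (fun p : ℝ × ℝ =>
      -deriv riemannZeta₁ (1 + (p.1 + Complex.I * p.2)) /
        riemannZeta₁ (1 + (p.1 + Complex.I * p.2)) ^ 2)
      (Set.Icc (0 : ℝ) 1 ×ˢ Set.Icc (-1 : ℝ) 1) := by
    refine ContinuousOn.div ?_ ?_ ?_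
    · exact (differentiable_riemannZeta₁.deriv.continuous.comp (by fun_prop)).neg.continuousOn
    · exact ((differentiable_riemannZeta₁.continuous.comp (by fun_prop)).pow 2).continuousOn
    · rintro ⟨p, q⟩ ⟨hp, -⟩
      exact pow_ne_zero _ (riemannZeta₁_ne_zero (by simpa using hp.1))
  obtain ⟨K, hK⟩ := (isCompact_Icc.prod isCompact_Icc).exists_bound_of_continuousOn hcont
  have hK0 : 0 ≤ |K| := abs_nonneg K
  refine ⟨2 * |K| + 6 * C / c ^ 2, by positivity, fun δ t hδ hδ1 => ?_⟩
  rw [hd δ t hδ.le]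
  rcases le_total |t| 1 with ht | ht
  · have h1 := hK (δ, t) ⟨⟨hδ.le, hδ1⟩, abs_le.mp ht⟩
    have h2 : (1 / 2 : ℝ) ≤ (1 + |t|) ^ (-(3 / 4) : ℝ) := by
      calc (1 / 2 : ℝ) = (2 : ℝ) ^ (-1 : ℝ) := by rw [Real.rpow_neg_one]; norm_num
        _ ≤ (2 : ℝ) ^ (-(3 / 4) : ℝ) :=
          Real.rpow_le_rpow_of_exponent_le (by norm_num) (by norm_num)
        _ ≤ _ := Real.rpow_le_rpow_of_nonpos (by positivity) (by linarith) (by norm_num)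
    have h3 : 0 ≤ 6 * C / c ^ 2 := by positivity
    refine h1.trans ((le_abs_self K).trans ?_)
    nlinarith
  · have ht0 : 0 < |t| := by linarith
    have hre : (1 + (δ + Complex.I * t) : ℂ).re = 1 + δ := by simp
    have him : (1 + (δ + Complex.I * t) : ℂ).im = t := by simp
    have hne : (1 + (δ + Complex.I * t) : ℂ) ≠ 1 := by
      intro h
      have := congrArg Complex.re h
      rw [hre] at this
      simp at this
      linarith
    obtain ⟨h1, h2⟩ := hz (1 + (δ + Complex.I * t)) (by rw [hre]; linarith)
      (by rw [hre]; linarith) (by rwa [him])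
    rw [him] at h1 h2
    have h3 := hl δ t hδ hδ1 ht
    rw [add_assoc] at h3
    rw [deriv_riemannZeta₁_eq hne, riemannZeta₁_eq hne, add_sub_cancel_left]
    set w : ℂ := δ + Complex.I * t
    have hw1 : |t| ≤ ‖w‖ := by simpa [w] using Complex.abs_im_le_norm w
    have hw2 : ‖w‖ ≤ 2 * |t| := by
      have := Complex.norm_le_abs_re_add_abs_im w
      simp only [w, Complex.add_re, Complex.ofReal_re, Complex.mul_re, Complex.I_re, zero_mul,
        Complex.I_im, Complex.ofReal_im, mul_zero, sub_self, add_zero, Complex.add_im,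
        Complex.mul_im, one_mul, zero_add, abs_of_pos hδ] at this
      linarith
    have hnum : ‖-(riemannZeta (1 + w) + w * deriv riemannZeta (1 + w))‖ ≤
        3 * C * |t| * |t| ^ (1 / 36 : ℝ) := by
      rw [norm_neg]
      refine (norm_add_le _ _).trans ?_
      rw [norm_mul]
      have : ‖w‖ * ‖deriv riemannZeta (1 + w)‖ ≤ 2 * |t| * (C * |t| ^ (1 / 36 : ℝ)) := by gcongr
      have hp : 0 ≤ C * |t| ^ (1 / 36 : ℝ) := by positivity
      nlinarith
    have hden : (|t| * (c * |t| ^ (-(1 / 9) : ℝ))) ^ 2 ≤ ‖(w * riemannZeta (1 + w)) ^ 2‖ := by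
      rw [norm_pow, norm_mul]
      gcongr
    rw [norm_div]
    calc _ ≤ 3 * C * |t| * |t| ^ (1 / 36 : ℝ) / (|t| * (c * |t| ^ (-(1 / 9) : ℝ))) ^ 2 := by
          gcongr
      _ = 3 * C / c ^ 2 * |t| ^ (-(3 / 4) : ℝ) := by
          have e1 : |t| ^ (1 / 36 : ℝ) = |t| * |t| ^ (-(3 / 4) : ℝ) *
              (|t| ^ (-(1 / 9) : ℝ)) ^ 2 := by
            rw [← Real.rpow_natCast (|t| ^ (-(1 / 9) : ℝ)), ← Real.rpow_mul ht0.le,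
              ← Real.rpow_one_add' ht0.le (by norm_num), ← Real.rpow_add ht0]
            norm_num
          rw [e1]
          have : |t| ^ (-(1 / 9) : ℝ) ≠ 0 := by positivity
          field_simp
      _ ≤ 3 * C / c ^ 2 * (2 * (1 + |t|) ^ (-(3 / 4) : ℝ)) := by
          gcongr
          calc |t| ^ (-(3 / 4) : ℝ) = 2 ^ (3 / 4 : ℝ) * (2 * |t|) ^ (-(3 / 4) : ℝ) := by
                rw [Real.mul_rpow (by norm_num) ht0.le, ← mul_assoc,
                  ← Real.rpow_add (by norm_num)]
                norm_num
            _ ≤ 2 ^ (1 : ℝ) * (1 + |t|) ^ (-(3 / 4) : ℝ) := by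
                gcongr ?_ * ?_
                · exact Real.rpow_le_rpow_of_exponent_le (by norm_num) (by norm_num)
                · exact Real.rpow_le_rpow_of_nonpos (by positivity) (by linarith) (by norm_num)
            _ = _ := by rw [Real.rpow_one]
      _ ≤ _ := by
          have h5 : 0 ≤ (1 + |t|) ^ (-(3 / 4) : ℝ) := by positivity
          have h6 : 3 * C / c ^ 2 * (2 * (1 + |t|) ^ (-(3 / 4) : ℝ)) =
            6 * C / c ^ 2 * (1 + |t|) ^ (-(3 / 4) : ℝ) := by ring
          nlinarith

/-- `∑_{d ≤ u} μ(d)/d`. -/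
noncomputable def mobSum (u : ℝ) : ℝ :=
  ∑ d ∈ Finset.Icc 1 ⌊u⌋₊, (ArithmeticFunction.moebius d : ℝ) / d

lemma abs_moebius_real_le_one (n : ℕ) : |(ArithmeticFunction.moebius n : ℝ)| ≤ 1 := by
  exact_mod_cast ArithmeticFunction.abs_moebius_le_one (n := n)

lemma mobSum_exp_of_neg {x : ℝ} (hx : x < 0) : mobSum (Real.exp x) = 0 := by
  rw [mobSum, Nat.floor_eq_zero.mpr (by simpa using hx)]
  simp

lemma measurable_mobSum_exp : Measurable fun x => mobSum (Real.exp x) := by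
  unfold mobSum
  exact (measurable_from_top (f := fun n : ℕ => ∑ d ∈ Finset.Icc 1 n,
    (ArithmeticFunction.moebius d : ℝ) / d)).comp (Nat.measurable_floor.comp Real.measurable_exp)

lemma abs_mobSum_le {u : ℝ} (hu : 1 ≤ u) : |mobSum u| ≤ 1 + Real.log u := by
  refine (Finset.abs_sum_le_sum_abs _ _).trans (le_trans ?_ (harmonic_floor_le_one_add_log u hu))
  rw [harmonic_eq_sum_Icc]
  push_cast
  refine Finset.sum_le_sum fun d _ => ?_
  rw [abs_div, Nat.abs_cast, ← one_div]
  gcongr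
  exact abs_moebius_real_le_one d

lemma sum_Icc_inv_le (a b : ℕ) (hab : a + 1 ≤ b) :
    ∑ d ∈ Finset.Ioc a b, (1 : ℝ) / d ≤ 1 / (a + 1 : ℝ) + Real.log (b / (a + 1)) := by
  induction b, hab using Nat.le_induction with
  | base =>
    have : ((a : ℝ) + 1) ≠ 0 := by positivity
    simp [this]
  | succ b hb ih =>
    have hb0 : (0 : ℝ) < b := by exact_mod_cast (by omega : 0 < b)
    rw [Finset.sum_Ioc_succ_top (by omega)]
    have h1 : Real.log ((b + 1 : ℕ) / (a + 1)) =
        Real.log (b / (a + 1)) - Real.log (b / (b + 1)) := by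
      rw [← Real.log_div (by positivity) (by positivity)]
      congr 1
      push_cast
      field_simp
    have h2 := Real.log_le_sub_one_of_pos (x := (b : ℝ) / (b + 1)) (by positivity)
    have h3 : (b : ℝ) / (b + 1) - 1 = -(1 / (b + 1)) := by field_simp; ring
    rw [h1]
    push_cast
    linarith

lemma abs_mobSum_exp_sub_le {x y : ℝ} (hxy : x ≤ y) :
    |mobSum (Real.exp y) - mobSum (Real.exp x)| ≤ (y - x) + Real.exp (-x) := by
  have hf : ⌊Real.exp x⌋₊ ≤ ⌊Real.exp y⌋₊ := Nat.floor_le_floor (Real.exp_le_exp.mpr hxy)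
  have h0 : mobSum (Real.exp y) - mobSum (Real.exp x) =
      ∑ d ∈ Finset.Ioc ⌊Real.exp x⌋₊ ⌊Real.exp y⌋₊, (ArithmeticFunction.moebius d : ℝ) / d := by
    rw [mobSum, mobSum, sub_eq_iff_eq_add']
    rw [← Finset.sum_union]
    · congr 1
      ext d
      simp only [Finset.mem_Icc, Finset.mem_union, Finset.mem_Ioc]
      omega
    · rw [Finset.disjoint_left]
      intro d
      simp only [Finset.mem_Icc, Finset.mem_Ioc]
      omega
  rw [h0]
  have h1 : |∑ d ∈ Finset.Ioc ⌊Real.exp x⌋₊ ⌊Real.exp y⌋₊,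
      (ArithmeticFunction.moebius d : ℝ) / d| ≤
      ∑ d ∈ Finset.Ioc ⌊Real.exp x⌋₊ ⌊Real.exp y⌋₊, (1 : ℝ) / d := by
    refine (Finset.abs_sum_le_sum_abs _ _).trans (Finset.sum_le_sum fun d _ => ?_)
    rw [abs_div, Nat.abs_cast]
    gcongr
    exact abs_moebius_real_le_one d
  refine h1.trans ?_
  rcases Nat.lt_or_ge ⌊Real.exp x⌋₊ ⌊Real.exp y⌋₊ with h | h
  · refine (sum_Icc_inv_le _ _ h).trans ?_
    have h2 : Real.exp x ≤ ⌊Real.exp x⌋₊ + 1 := (Nat.lt_floor_add_one _).le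
    have h3 : (⌊Real.exp y⌋₊ : ℝ) ≤ Real.exp y := Nat.floor_le (Real.exp_pos y).le
    have h4 : (1 : ℝ) ≤ ⌊Real.exp y⌋₊ := by exact_mod_cast (by omega : 1 ≤ ⌊Real.exp y⌋₊)
    have h5 : Real.log (⌊Real.exp y⌋₊ / (⌊Real.exp x⌋₊ + 1)) ≤ y - x := by
      rw [← Real.log_exp (y - x), Real.exp_sub]
      apply Real.log_le_log (by positivity)
      gcongr
    have h6 : 1 / ((⌊Real.exp x⌋₊ : ℝ) + 1) ≤ Real.exp (-x) := by
      rw [Real.exp_neg, ← one_div]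
      gcongr
    linarith
  · rw [Finset.Ioc_eq_empty (by omega), Finset.sum_empty]
    have := Real.exp_pos (-x)
    linarith

lemma integrable_pow_mul_mobSum_exp {δ : ℝ} (hδ : 0 < δ) {k : ℕ} (hk : k ≤ 1) (t : ℝ) :
    Integrable fun x : ℝ => (x : ℂ) ^ k *
      ((mobSum (Real.exp x) : ℂ) * Complex.exp (-(δ + Complex.I * t) * x)) := by
  have hmeas : AEStronglyMeasurable (fun x : ℝ => (x : ℂ) ^ k *
      ((mobSum (Real.exp x) : ℂ) * Complex.exp (-(δ + Complex.I * t) * x))) volume := by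
    apply Measurable.aestronglyMeasurable
    have := measurable_mobSum_exp
    fun_prop
  have hint : Integrable ((Set.Ioi (0 : ℝ)).indicator
      fun x => (1 + 4 / δ) ^ 2 * Real.exp (-(δ / 2) * x)) := by
    rw [integrable_indicator_iff measurableSet_Ioi]
    exact (integrableOn_exp_mul_Ioi (by linarith : -(δ / 2) < 0) 0).const_mul _
  refine hint.mono' hmeas ?_
  filter_upwards [Measure.ae_ne volume (0 : ℝ)] with x hx
  rcases lt_or_gt_of_ne hx with hx | hx
  · rw [mobSum_exp_of_neg hx]
    simp [hx.le]
  · rw [Set.indicator_of_mem (by exact hx)]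
    have h1 : ‖Complex.exp (-(δ + Complex.I * t) * x)‖ = Real.exp (-(δ * x)) := by
      rw [Complex.norm_exp]; simp
    have h2 : |mobSum (Real.exp x)| ≤ 1 + x := by
      have := abs_mobSum_le (Real.one_le_exp hx.le)
      rwa [Real.log_exp] at this
    have h3 : |x| ^ k ≤ 1 + x := by
      rw [abs_of_pos hx]
      interval_cases k <;> simp [hx.le]
    have h4 : 1 + x ≤ (1 + 4 / δ) * Real.exp (δ / 4 * x) := by
      have h5 : 1 ≤ Real.exp (δ / 4 * x) := Real.one_le_exp (by positivity)
      have h6 : δ / 4 * x ≤ Real.exp (δ / 4 * x) := by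
        linarith [Real.add_one_le_exp (δ / 4 * x)]
      have h7 : x = 4 / δ * (δ / 4 * x) := by field_simp
      have h8 : 4 / δ * (δ / 4 * x) ≤ 4 / δ * Real.exp (δ / 4 * x) := by gcongr
      linarith
    rw [norm_mul, norm_mul, norm_pow, Complex.norm_real, Complex.norm_real, h1, Real.norm_eq_abs,
      Real.norm_eq_abs]
    calc |x| ^ k * (|mobSum (Real.exp x)| * Real.exp (-(δ * x))) ≤
        (1 + x) * ((1 + x) * Real.exp (-(δ * x))) := by gcongr
      _ ≤ ((1 + 4 / δ) * Real.exp (δ / 4 * x)) *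
          (((1 + 4 / δ) * Real.exp (δ / 4 * x)) * Real.exp (-(δ * x))) := by gcongr
      _ = (1 + 4 / δ) ^ 2 * (Real.exp (δ / 4 * x) * Real.exp (δ / 4 * x) *
          Real.exp (-(δ * x))) := by ring
      _ = _ := by
        rw [← Real.exp_add, ← Real.exp_add]
        congr 2
        ring

lemma integral_mobSum_exp {s : ℂ} (hs : 0 < s.re) :
    ∫ x : ℝ, (mobSum (Real.exp x) : ℂ) * Complex.exp (-s * x) = (riemannZeta₁ (1 + s))⁻¹ := by
  have hs0 : s ≠ 0 := by rintro rfl; simp at hs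
  set F : ℕ → ℝ → ℂ := fun n => (Set.Ici (Real.log n)).indicator
    fun x => ((ArithmeticFunction.moebius n : ℝ) / n : ℝ) * Complex.exp (-s * x) with hF
  have hF_int : ∀ n, Integrable (F n) := by
    intro n
    rw [hF, integrable_indicator_iff measurableSet_Ici, integrableOn_Ici_iff_integrableOn_Ioi]
    exact (integrableOn_exp_mul_complex_Ioi (by simpa using hs) _).const_mul _
  have hF_eq : ∀ n, ∫ x, F n x = LSeries.term (fun n => (ArithmeticFunction.moebius n : ℂ))
      (1 + s) n / s := by
    intro n
    rw [hF, integral_indicator measurableSet_Ici, integral_Ici_eq_integral_Ioi,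
      integral_const_mul, integral_exp_mul_complex_Ioi (by simpa using hs)]
    rcases Nat.eq_zero_or_pos n with rfl | hn
    · simp
    · have hn' : (n : ℂ) ≠ 0 := by exact_mod_cast hn.ne'
      rw [LSeries.term_of_ne_zero hn.ne', Complex.cpow_add _ _ hn', Complex.cpow_one,
        Complex.cpow_def_of_ne_zero hn', Complex.ofReal_log (by positivity)]
      push_cast
      rw [neg_mul, mul_comm s, Complex.exp_neg]
      have := Complex.exp_ne_zero (Complex.log n * s)
      field_simp
  have hF_norm : ∀ n, ∫ x, ‖F n x‖ ≤ 1 / (n : ℝ) ^ (1 + s.re) / s.re := by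
    intro n
    have h1 : (fun x => ‖F n x‖) = (Set.Ici (Real.log n)).indicator
        fun x => |(ArithmeticFunction.moebius n : ℝ) / n| * Real.exp (-s.re * x) := by
      ext x
      rw [hF, norm_indicator_eq_indicator_norm]
      congr 1
      ext x
      rw [norm_mul, Complex.norm_real, Complex.norm_exp, Real.norm_eq_abs]
      simp
    rw [h1, integral_indicator measurableSet_Ici, integral_Ici_eq_integral_Ioi,
      integral_const_mul, integral_exp_mul_Ioi (by linarith)]
    rcases Nat.eq_zero_or_pos n with rfl | hn
    · simp
      positivity
    · have hn' : (0 : ℝ) < n := by exact_mod_cast hn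
      have h2 : Real.exp (-s.re * Real.log n) = ((n : ℝ) ^ s.re)⁻¹ := by
        rw [← Real.rpow_neg hn'.le, Real.rpow_def_of_pos hn', mul_comm]
      have h3 : |(ArithmeticFunction.moebius n : ℝ) / n| ≤ 1 / n := by
        rw [abs_div, Nat.abs_cast]
        gcongr
        exact abs_moebius_real_le_one n
      rw [h2, Real.rpow_add hn', Real.rpow_one, neg_div_neg_eq]
      calc _ ≤ 1 / (n : ℝ) * (((n : ℝ) ^ s.re)⁻¹ / s.re) := by gcongr
        _ = _ := by field_simp
  have hsum : Summable fun n => ∫ x, ‖F n x‖ := by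
    refine Summable.of_nonneg_of_le (fun n => integral_nonneg fun x => norm_nonneg _) hF_norm ?_
    exact (Real.summable_one_div_nat_rpow.mpr (by linarith)).div_const _
  have h := (hasSum_integral_of_summable_integral_norm hF_int hsum).tsum_eq
  have h2 : ∀ x, ∑' n, F n x = (mobSum (Real.exp x) : ℂ) * Complex.exp (-s * x) := by
    intro x
    rw [tsum_eq_sum (s := Finset.Icc 1 ⌊Real.exp x⌋₊), mobSum, Complex.ofReal_sum,
      Finset.sum_mul]
    · refine Finset.sum_congr rfl fun n hn => ?_
      rw [Finset.mem_Icc, Nat.le_floor_iff (Real.exp_pos x).le] at hn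
      rw [hF]
      refine Set.indicator_of_mem ?_ _
      rw [Set.mem_Ici, Real.log_le_iff_le_exp (by exact_mod_cast hn.1)]
      exact hn.2
    · intro n hn
      rw [Finset.mem_Icc, not_and_or, not_le, not_le, Nat.lt_one_iff] at hn
      rcases hn with rfl | hn
      · simp [hF]
      · rw [Nat.floor_lt (Real.exp_pos x).le] at hn
        rw [hF]
        refine Set.indicator_of_notMem ?_ _
        rw [Set.mem_Ici, not_le]
        rwa [Real.lt_log_iff_exp_lt ((Real.exp_pos x).trans hn)]
  simp_rw [h2, hF_eq] at h
  rw [← h, tsum_div_const]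
  have h4 : (1 : ℝ) < (1 + s).re := by simpa using hs
  have h3 := ArithmeticFunction.LSeries_zeta_mul_Lseries_moebius h4
  rw [ArithmeticFunction.LSeries_zeta_eq_riemannZeta h4] at h3
  rw [riemannZeta₁_eq (by simpa using hs0), add_sub_cancel_left, mul_inv, mul_comm,
    div_eq_mul_inv]
  congr 1
  exact eq_inv_of_mul_eq_one_right h3

section FourierAnalysis

open scoped FourierTransform ContDiff

lemma norm_fourier_mul_mobSum_exp_le : ∃ C > (0 : ℝ), ∀ δ ξ : ℝ, 0 < δ → δ ≤ 1 →
    ‖𝓕 (fun x : ℝ => (x : ℂ) * ((mobSum (Real.exp x) : ℂ) * Complex.exp (-δ * x))) ξ‖ ^ 2 ≤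
      C * (1 + |ξ|) ^ (-(3 / 2) : ℝ) := by
  obtain ⟨C, hC, hD⟩ := norm_deriv_inv_riemannZeta₁_le
  refine ⟨C ^ 2, by positivity, fun δ ξ hδ hδ1 => ?_⟩
  set g : ℝ → ℂ := fun x => (mobSum (Real.exp x) : ℂ) * Complex.exp (-δ * x) with hg
  have hg1 : Integrable g := by
    have := integrable_pow_mul_mobSum_exp hδ (k := 0) (by norm_num) 0
    simpa [hg] using this
  have hg2 : Integrable fun x : ℝ => x • g x := by
    have := integrable_pow_mul_mobSum_exp hδ (k := 1) le_rfl 0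
    simpa [hg, Complex.real_smul] using this
  have h1 : 𝓕 g = fun ξ : ℝ => (riemannZeta₁ (1 + (δ + Complex.I * (2 * Real.pi * ξ : ℝ))))⁻¹ := by
    ext ξ
    rw [← integral_mobSum_exp (by simpa using hδ), Real.fourier_real_eq_integral_exp_smul]
    refine integral_congr_ae (Eventually.of_forall fun x => ?_)
    simp only [hg, smul_eq_mul]
    rw [mul_left_comm, ← Complex.exp_add]
    congr 2
    push_cast
    ring
  have h2 := Real.hasDerivAt_fourier hg1 hg2 ξ
  have hz : DifferentiableAt ℂ (fun s => (riemannZeta₁ (1 + s))⁻¹)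
      (δ + Complex.I * (2 * Real.pi * ξ : ℝ)) := by
    refine DifferentiableAt.inv ?_ (riemannZeta₁_ne_zero (by simp [hδ.le]))
    exact (differentiable_riemannZeta₁ _).comp _ (by fun_prop)
  have h3 : HasDerivAt (fun ξ : ℝ => (δ + Complex.I * (2 * Real.pi * ξ : ℝ) : ℂ))
      (Complex.I * (2 * Real.pi)) ξ := by
    have : HasDerivAt (fun ξ : ℝ => ((2 * Real.pi * ξ : ℝ) : ℂ)) ((2 * Real.pi * 1 : ℝ) : ℂ) ξ :=
      ((hasDerivAt_id ξ).const_mul (2 * Real.pi)).ofReal_comp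
    have := (this.const_mul Complex.I).const_add (δ : ℂ)
    simpa using this
  have h4 := hz.hasDerivAt.comp ξ h3
  have h5 : 𝓕 (fun x : ℝ => (-2 * Real.pi * Complex.I * x) • g x) ξ =
      -(2 * Real.pi * Complex.I) * 𝓕 (fun x : ℝ => (x : ℂ) * g x) ξ := by
    rw [Real.fourier_real_eq_integral_exp_smul, Real.fourier_real_eq_integral_exp_smul,
      ← integral_const_mul]
    refine integral_congr_ae (Eventually.of_forall fun x => ?_)
    simp only [smul_eq_mul]
    ring
  rw [h1] at h2
  have h6 := h2.unique h4
  rw [h5] at h6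
  have h7 : 𝓕 (fun x : ℝ => (x : ℂ) * g x) ξ =
      -deriv (fun s => (riemannZeta₁ (1 + s))⁻¹) (δ + Complex.I * (2 * Real.pi * ξ : ℝ)) := by
    have hpi : (Real.pi : ℂ) ≠ 0 := by exact_mod_cast Real.pi_ne_zero
    have hne : -(2 * Real.pi * Complex.I) ≠ 0 := by simp [hpi]
    apply mul_left_cancel₀ hne
    rw [h6]
    ring
  rw [h7, norm_neg]
  have h8 := hD δ (2 * Real.pi * ξ) hδ hδ1
  refine (pow_le_pow_left₀ (norm_nonneg _) h8 2).trans ?_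
  calc
    _ ≤ (C * (1 + |ξ|) ^ (-(3 / 4) : ℝ)) ^ 2 := by
      gcongr ?_ ^ 2
      refine mul_le_mul_of_nonneg_left ?_ hC.le
      refine Real.rpow_le_rpow_of_nonpos (by positivity) ?_ (by norm_num)
      rw [abs_mul, abs_of_pos (by positivity : 0 < 2 * Real.pi)]
      have : 1 ≤ 2 * Real.pi := by linarith [Real.pi_gt_three]
      nlinarith [abs_nonneg ξ]
    _ = _ := by
      rw [mul_pow, ← Real.rpow_natCast ((1 + |ξ|) ^ (-(3 / 4) : ℝ)),
        ← Real.rpow_mul (by positivity)]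
      norm_num

lemma norm_integral_mul_schwartz_le {f : ℝ → ℂ} (hf : Integrable f) (w : ℝ → ℝ)
    (hw : Integrable w) (hfw : ∀ ξ, ‖𝓕 f ξ‖ ^ 2 ≤ w ξ) (ϕ : SchwartzMap ℝ ℂ) {l : ℝ}
    (hl : 0 < l) :
    ‖∫ x, f x * ϕ x‖ ≤ l / 2 * (∫ ξ, w ξ) + 1 / (2 * l) * ∫ x, ‖ϕ x‖ ^ 2 := by
  set g : SchwartzMap ℝ ℂ := 𝓕⁻ ϕ with hg
  have hϕ : 𝓕 g = ϕ := FourierTransform.fourier_fourierInv_eq ϕ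
  have h1 : ∫ x, f x * ϕ x = ∫ ξ, 𝓕 f ξ * g ξ := by
    have := VectorFourier.integral_fourierIntegral_smul_eq_flip (L := innerₗ ℝ)
      Real.continuous_fourierChar continuous_inner hf g.integrable (μ := volume) (ν := volume)
    rw [← hϕ, SchwartzMap.fourier_coe]
    simpa using! this.symm
  have h2 : ∫ x, ‖ϕ x‖ ^ 2 = ∫ x, ‖g x‖ ^ 2 := by
    rw [← SchwartzMap.integral_norm_sq_fourier g, hϕ]
  have hg2 : Integrable fun x => ‖g x‖ ^ 2 := (memLp_two_iff_integrable_sq_norm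
    g.continuous.aestronglyMeasurable).mp (g.memLp 2 volume)
  rw [h1, h2, ← integral_const_mul, ← integral_const_mul, ← integral_add (hw.const_mul _)
    (hg2.const_mul _)]
  refine norm_integral_le_of_norm_le ((hw.const_mul _).add (hg2.const_mul _))
    (Eventually.of_forall fun ξ => ?_)
  rw [norm_mul]
  calc ‖𝓕 f ξ‖ * ‖g ξ‖ ≤ l / 2 * ‖𝓕 f ξ‖ ^ 2 + 1 / (2 * l) * ‖g ξ‖ ^ 2 := by
        have : l / 2 * ‖𝓕 f ξ‖ ^ 2 + 1 / (2 * l) * ‖g ξ‖ ^ 2 - ‖𝓕 f ξ‖ * ‖g ξ‖ =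
            1 / (2 * l) * (l * ‖𝓕 f ξ‖ - ‖g ξ‖) ^ 2 := by field_simp; ring
        have h3 : 0 ≤ 1 / (2 * l) * (l * ‖𝓕 f ξ‖ - ‖g ξ‖) ^ 2 := by positivity
        linarith
    _ ≤ _ := by
        have := hfw ξ
        gcongr

lemma integral_sq_bump_le {c h : ℝ} (hh : 0 < h) (b : ContDiffBump c) (hb : b.rOut = h / 2) :
    ∫ y, ‖((b y : ℝ) : ℂ)‖ ^ 2 ≤ h := by
  have h1 : ∫ y, (Metric.ball c (h / 2)).indicator (fun _ => (1 : ℝ)) y = h := by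
    rw [integral_indicator Metric.isOpen_ball.measurableSet, setIntegral_const, smul_eq_mul,
      mul_one, Measure.real, Real.volume_ball, ENNReal.toReal_ofReal (by linarith)]
    ring
  rw [← h1]
  refine integral_mono_of_nonneg (Eventually.of_forall fun y => by positivity) ?_
    (Eventually.of_forall fun y => ?_)
  · rw [integrable_indicator_iff Metric.isOpen_ball.measurableSet]
    exact integrableOn_const measure_ball_lt_top.ne
  · dsimp only
    rw [Complex.norm_real, Real.norm_of_nonneg b.nonneg]
    by_cases hy : y ∈ Metric.ball c (h / 2)
    · rw [Set.indicator_of_mem hy]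
      exact pow_le_one₀ b.nonneg b.le_one
    · rw [Set.indicator_of_notMem hy, b.zero_of_le_dist]
      · simp
      · rw [hb]; simpa using hy

set_option maxHeartbeats 1000000 in
lemma mul_min_abs_mobSum_exp_le : ∃ C > (0 : ℝ), ∀ x : ℝ, 1 ≤ x →
    x * (min |mobSum (Real.exp x)| 1) ^ (3 / 2 : ℝ) ≤ C := by
  obtain ⟨C, hC, hF⟩ := norm_fourier_mul_mobSum_exp_le
  have hw : Integrable fun ξ : ℝ => C * (1 + |ξ|) ^ (-(3 / 2) : ℝ) := by
    have := integrable_one_add_norm (E := ℝ) (μ := volume) (r := 3 / 2) (by simp; norm_num)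
    simpa [Real.norm_eq_abs] using this.const_mul C
  set K := ∫ ξ : ℝ, C * (1 + |ξ|) ^ (-(3 / 2) : ℝ) with hK
  have hK0 : 0 ≤ K := integral_nonneg fun ξ => by positivity
  refine ⟨4 * Real.exp 1 * (K + 1) + 4, by positivity, fun x hx => ?_⟩
  set η := min |mobSum (Real.exp x)| 1 with hη
  have hη0 : 0 ≤ η := le_min (abs_nonneg _) zero_le_one
  have hη1 : η ≤ 1 := min_le_right _ _
  have hη2 : η ≤ |mobSum (Real.exp x)| := min_le_left _ _
  have hexp : 0 ≤ 4 * Real.exp 1 * (K + 1) := by positivity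
  rcases lt_or_ge (η / 4) (Real.exp (-x)) with hsm | hbig
  · have h1 : η ^ (3 / 2 : ℝ) ≤ η := by
      conv_rhs => rw [← Real.rpow_one η]
      exact Real.rpow_le_rpow_of_exponent_ge' hη0 hη1 (by norm_num) (by norm_num)
    have h2 : x * Real.exp (-x) ≤ 1 := by
      rw [Real.exp_neg, ← div_eq_mul_inv, div_le_one (Real.exp_pos x)]
      linarith [Real.add_one_le_exp x]
    nlinarith
  have hηpos : 0 < η := by linarith [Real.exp_pos (-x)]
  set h := η / 4 with hh
  have hh0 : 0 < h := by positivity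
  have hh1 : h ≤ 1 := by linarith
  set δ := 1 / (x + 1) with hδ
  have hδ0 : 0 < δ := by positivity
  have hδ1 : δ ≤ 1 := by rw [hδ, div_le_one (by positivity)]; linarith
  set b : ContDiffBump (x + h / 2) := ⟨h / 4, h / 2, by positivity, by linarith⟩ with hb
  set ϕ : SchwartzMap ℝ ℂ := HasCompactSupport.toSchwartzMap (f := fun y => ((b y : ℝ) : ℂ))
    (b.hasCompactSupport.comp_left (g := Complex.ofReal) Complex.ofReal_zero)
    (Complex.ofRealCLM.contDiff.comp b.contDiff) with hϕ
  have hϕb : ∀ y, ϕ y = ((b y : ℝ) : ℂ) := fun y => rfl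
  have hf : Integrable fun y : ℝ => (y : ℂ) * ((mobSum (Real.exp y) : ℂ) *
      Complex.exp (-δ * y)) := by
    have := integrable_pow_mul_mobSum_exp hδ0 (k := 1) le_rfl 0
    simpa using this
  have h1 := norm_integral_mul_schwartz_le hf _ hw (fun ξ => hF δ ξ hδ0 hδ1) ϕ
    (Real.sqrt_pos.mpr hh0)
  rw [← hK] at h1
  set r : ℝ → ℝ := fun y => y * (mobSum (Real.exp y) * Real.exp (-δ * y)) * b y with hr
  have h2 : ∀ y : ℝ, (y : ℂ) * ((mobSum (Real.exp y) : ℂ) * Complex.exp (-δ * y)) * ϕ y =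
      ((r y : ℝ) : ℂ) := by
    intro y
    rw [hϕb, hr]
    push_cast
    rfl
  have hrint : Integrable r := by
    have : Integrable fun y => ((r y : ℝ) : ℂ) := by
      refine hf.mono ?_ (Eventually.of_forall fun y => ?_)
      · simp_rw [← h2]
        exact hf.aestronglyMeasurable.mul ϕ.continuous.aestronglyMeasurable
      · rw [← h2, norm_mul _ (ϕ y), hϕb, Complex.norm_real, Real.norm_of_nonneg b.nonneg]
        exact mul_le_of_le_one_right (norm_nonneg _) b.le_one
    simpa using this.re
  simp_rw [h2] at h1
  rw [integral_complex_ofReal, Complex.norm_real, Real.norm_eq_abs] at h1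
  have h3 : ∫ y, ‖ϕ y‖ ^ 2 ≤ h := integral_sq_bump_le hh0 b rfl
  have hsq : Real.sqrt h * Real.sqrt h = h := Real.mul_self_sqrt hh0.le
  have hsq0 := Real.sqrt_pos.mpr hh0
  have h4 : |∫ y, r y| ≤ Real.sqrt h * (K + 1) / 2 := by
    refine h1.trans ?_
    have : 1 / (2 * Real.sqrt h) * ∫ y, ‖ϕ y‖ ^ 2 ≤ 1 / (2 * Real.sqrt h) * h := by gcongr
    have h5 : 1 / (2 * Real.sqrt h) * h = Real.sqrt h / 2 := by
      nth_rewrite 2 [← hsq]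
      field_simp
    linarith
  obtain ⟨σ, hσ, hσM⟩ : ∃ σ : ℝ, |σ| = 1 ∧ σ * mobSum (Real.exp x) = |mobSum (Real.exp x)| := by
    rcases le_total 0 (mobSum (Real.exp x)) with h | h
    · exact ⟨1, by simp, by rw [abs_of_nonneg h, one_mul]⟩
    · exact ⟨-1, by simp, by rw [abs_of_nonpos h, neg_one_mul]⟩
  have hwin : ∀ y, x ≤ y → y ≤ x + h → η / 2 ≤ σ * mobSum (Real.exp y) := by
    intro y hy1 hy2
    have h5 := abs_mobSum_exp_sub_le hy1
    have h6 : |σ * (mobSum (Real.exp y) - mobSum (Real.exp x))| ≤ (y - x) + Real.exp (-x) := by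
      rwa [abs_mul, hσ, one_mul]
    have h7 := (abs_le.mp h6).1
    rw [mul_sub, hσM] at h7
    linarith
  have hlow : ∀ y, x ≤ y → y ≤ x + h →
      x * (η / 2 * Real.exp (-1)) * b y ≤ σ * r y := by
    intro y hy1 hy2
    have h5 : Real.exp (-1) ≤ Real.exp (-δ * y) := by
      rw [Real.exp_le_exp, hδ]
      have : 1 / (x + 1) * y ≤ 1 := by
        rw [one_div, inv_mul_le_iff₀ (by positivity)]
        linarith
      linarith
    have h6 := hwin y hy1 hy2
    have h7 : σ * r y = y * ((σ * mobSum (Real.exp y)) * Real.exp (-δ * y)) * b y := by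
      rw [hr]; ring
    have h8 : 0 ≤ b y := b.nonneg
    have hy0 : 0 ≤ y := by linarith
    have hM0 : 0 ≤ σ * mobSum (Real.exp y) := by linarith
    rw [h7]
    gcongr
  have h5 : x * (η / 2 * Real.exp (-1)) * (h / 2) ≤ ∫ y, σ * r y := by
    have h6 : ∫ y, (Metric.closedBall (x + h / 2) (h / 4)).indicator
        (fun _ => x * (η / 2 * Real.exp (-1))) y = x * (η / 2 * Real.exp (-1)) * (h / 2) := by
      rw [integral_indicator Metric.isClosed_closedBall.measurableSet, setIntegral_const,
        smul_eq_mul, Measure.real, Real.volume_closedBall, ENNReal.toReal_ofReal (by linarith)]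
      ring
    rw [← h6]
    refine integral_mono ?_ (hrint.const_mul σ) fun y => ?_
    · rw [integrable_indicator_iff Metric.isClosed_closedBall.measurableSet]
      exact integrableOn_const measure_closedBall_lt_top.ne
    · dsimp only
      by_cases hy : y ∈ Metric.closedBall (x + h / 2) (h / 4)
      · rw [Set.indicator_of_mem hy]
        have hy2 := hy
        rw [Metric.mem_closedBall, Real.dist_eq, abs_le] at hy2
        have := hlow y (by linarith) (by linarith)
        rwa [b.one_of_mem_closedBall hy, mul_one] at this
      · rw [Set.indicator_of_notMem hy]
        by_cases hy2 : y ∈ Metric.ball (x + h / 2) (h / 2)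
        · rw [Metric.mem_ball, Real.dist_eq, abs_lt] at hy2
          refine le_trans ?_ (hlow y (by linarith) (by linarith))
          have h8 : 0 ≤ b y := b.nonneg
          positivity
        · have : b y = 0 := b.zero_of_le_dist (by simpa using hy2)
          rw [hr]
          simp [this]
  have h6 : ∫ y, σ * r y ≤ |∫ y, r y| := by
    rw [integral_const_mul]
    calc _ ≤ |σ * ∫ y, r y| := le_abs_self _
      _ = _ := by rw [abs_mul, hσ, one_mul]
  have h7 : x * (η / 2 * Real.exp (-1)) * (h / 2) ≤ Real.sqrt h * (K + 1) / 2 :=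
    h5.trans (h6.trans h4)
  have h8 : Real.sqrt h = η ^ (1 / 2 : ℝ) / 2 := by
    rw [hh, Real.sqrt_div hη0, ← Real.sqrt_eq_rpow]
    congr 1
    rw [show (4 : ℝ) = 2 ^ 2 by norm_num, Real.sqrt_sq (by norm_num)]
  have h9 : x * (η / 2 * Real.exp (-1)) * Real.sqrt h ≤ K + 1 := by
    have : x * (η / 2 * Real.exp (-1)) * (h / 2) =
      Real.sqrt h * (x * (η / 2 * Real.exp (-1)) * Real.sqrt h) / 2 := by
      rw [← hsq, Real.sqrt_mul_self hsq0.le]; ring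
    rw [this, div_le_div_iff_of_pos_right (by norm_num)] at h7
    exact le_of_mul_le_mul_left h7 hsq0
  have h10 : η ^ (3 / 2 : ℝ) = η * η ^ (1 / 2 : ℝ) := by
    rw [← Real.rpow_one_add' hη0 (by norm_num)]
    norm_num
  have h11 : x * η ^ (3 / 2 : ℝ) =
      4 * Real.exp 1 * (x * (η / 2 * Real.exp (-1)) * Real.sqrt h) := by
    rw [h8, h10, Real.exp_neg]
    field_simp
    ring
  rw [h11]
  have : 4 * Real.exp 1 * (x * (η / 2 * Real.exp (-1)) * Real.sqrt h) ≤
    4 * Real.exp 1 * (K + 1) := by gcongr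
  linarith

/-- `∑_{d ≤ u} μ(d)/d ≪ (1 + log u)^{-2/3}`. -/
lemma abs_mobSum_le_rpow : ∃ C > (0 : ℝ), ∀ u : ℝ, 1 ≤ u →
    |mobSum u| ≤ C * (1 + Real.log u) ^ (-(2 / 3) : ℝ) := by
  obtain ⟨C, hC, hM⟩ := mul_min_abs_mobSum_exp_le
  refine ⟨(2 * C) ^ (2 / 3 : ℝ) + (2 + C) ^ 2, by positivity, fun u hu => ?_⟩
  have hx0 := Real.log_nonneg hu
  set x := Real.log u with hx
  have hux : u = Real.exp x := by rw [hx, Real.exp_log (by linarith)]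
  have hp : 0 < (1 + x) ^ (-(2 / 3) : ℝ) := by positivity
  rw [add_mul]
  rcases lt_or_ge x (1 + C) with h | h
  · have h1 := abs_mobSum_le hu
    have h2 : (1 + x) = (1 + x) ^ (5 / 3 : ℝ) * (1 + x) ^ (-(2 / 3) : ℝ) := by
      rw [← Real.rpow_add (by positivity)]; norm_num
    have h3 : (1 + x) ^ (5 / 3 : ℝ) ≤ (2 + C) ^ 2 := by
      rw [← Real.rpow_natCast (2 + C)]
      calc (1 + x) ^ (5 / 3 : ℝ) ≤ (2 + C) ^ (5 / 3 : ℝ) := by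
            exact Real.rpow_le_rpow (by positivity) (by linarith) (by norm_num)
        _ ≤ _ := Real.rpow_le_rpow_of_exponent_le (by linarith) (by norm_num)
    have h4 : (1 + x) ^ (5 / 3 : ℝ) * (1 + x) ^ (-(2 / 3) : ℝ) ≤
      (2 + C) ^ 2 * (1 + x) ^ (-(2 / 3) : ℝ) := by gcongr
    have h5 : 0 ≤ (2 * C) ^ (2 / 3 : ℝ) * (1 + x) ^ (-(2 / 3) : ℝ) := by positivity
    linarith
  · have h1 := hM x (by linarith)
    rw [← hux] at h1
    have hx1 : 0 < x := by linarith
    have h2 : (min |mobSum u| 1) ^ (3 / 2 : ℝ) ≤ C / x := by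
      rw [le_div_iff₀ hx1]; linarith
    have h3 : min |mobSum u| 1 = |mobSum u| := by
      refine min_eq_left (le_of_lt ?_)
      by_contra! h3
      rw [min_eq_right h3, Real.one_rpow, le_div_iff₀ hx1] at h2
      linarith
    rw [h3] at h2
    have h4 : C / x ≤ 2 * C * (1 + x)⁻¹ := by
      rw [← div_eq_mul_inv, div_le_div_iff₀ hx1 (by linarith)]
      nlinarith
    have h5 := Real.rpow_le_rpow (by positivity) (h2.trans h4) (by norm_num : (0 : ℝ) ≤ 2 / 3)
    rw [← Real.rpow_mul (abs_nonneg _), Real.mul_rpow (by positivity) (by positivity),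
      Real.inv_rpow (by positivity), ← Real.rpow_neg (by positivity)] at h5
    norm_num at h5
    have h6 : 0 ≤ (2 + C) ^ 2 * (1 + x) ^ (-(2 / 3) : ℝ) := by positivity
    norm_num at h6 ⊢
    linarith

end FourierAnalysis

namespace ArithmeticFunction

lemma mul_apply_prime_pow (f g : ArithmeticFunction ℝ) {p : ℕ} (hp : p.Prime) (i : ℕ) :
    (f * g) (p ^ i) = ∑ j ∈ Finset.range (i + 1), f (p ^ j) * g (p ^ (i - j)) := by
  rw [mul_apply, Nat.sum_divisorsAntidiagonal (f := fun a b => f a * g b),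
    Nat.sum_divisors_prime_pow hp]
  refine Finset.sum_congr rfl fun j hj => ?_
  rw [Nat.pow_div (by rw [Finset.mem_range] at hj; omega) hp.pos]

/-- The function `n ↦ 1/n`. -/
noncomputable def invId : ArithmeticFunction ℝ := ⟨fun n => 1 / (n : ℝ), by simp⟩

@[simp] lemma invId_apply (n : ℕ) : invId n = 1 / (n : ℝ) := rfl

/-- The function `n ↦ μ(n)/n`. -/
noncomputable def mobInvId : ArithmeticFunction ℝ := ⟨fun n => (moebius n : ℝ) / n, by simp⟩

@[simp] lemma mobInvId_apply (n : ℕ) : mobInvId n = (moebius n : ℝ) / n := rfl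

lemma isMultiplicative_invId : invId.IsMultiplicative := by
  refine ⟨by simp, fun {m n} _ => ?_⟩
  simp [mul_comm]

lemma isMultiplicative_mobInvId : mobInvId.IsMultiplicative := by
  refine ⟨by simp, fun {m n} h => ?_⟩
  simp only [mobInvId_apply, isMultiplicative_moebius.map_mul_of_coprime h]
  push_cast
  rw [mul_div_mul_comm]

lemma mobInvId_mul_invId : mobInvId * invId = 1 := by
  rw [(isMultiplicative_mobInvId.mul isMultiplicative_invId).eq_iff_eq_on_prime_powers _ _
    isMultiplicative_one]
  intro p i hp
  have hp0 : (p : ℝ) ≠ 0 := by exact_mod_cast hp.ne_zero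
  rw [mul_apply_prime_pow _ _ hp]
  rcases i with - | i
  · simp
  · rw [Finset.sum_range_succ', Finset.sum_range_succ',
      Finset.sum_eq_zero (fun j _ => by
        simp [moebius_apply_prime_pow hp (by omega : j + 1 + 1 ≠ 0)]), one_apply_ne]
    · simp only [mobInvId_apply, invId_apply, zero_add, pow_one, pow_zero, tsub_zero,
        moebius_apply_prime hp, add_tsub_cancel_right]
      push_cast
      rw [pow_succ]
      simp
      field_simp
      ring
    · exact (Nat.one_lt_pow (by omega) hp.one_lt).ne'

lemma mul_invId_mul_mobInvId (f : ArithmeticFunction ℝ) : (f * invId) * mobInvId = f := by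
  rw [mul_assoc, mul_comm invId, mobInvId_mul_invId, mul_one]

lemma mul_mobInvId_mul_invId (f : ArithmeticFunction ℝ) : (f * mobInvId) * invId = f := by
  rw [mul_assoc, mobInvId_mul_invId, mul_one]

end ArithmeticFunction

lemma psiM_mul {m a b : ℕ} (h : a.Coprime b) : psiM m (a * b) = psiM m a * psiM m b := by
  unfold psiM
  rw [h.primeFactors_mul, Finset.filter_union, Finset.prod_union]
  exact Finset.disjoint_filter_filter h.disjoint_primeFactors

lemma psiM_pos (m n : ℕ) : 0 < psiM m n := Finset.prod_pos fun _ _ => Nat.succ_pos _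

lemma psiM_one (m : ℕ) : psiM m 1 = 1 := by simp [psiM]

lemma psiM_prime {m p : ℕ} (hp : p.Prime) : psiM m p = if p ∣ m then 1 else p + 1 := by
  unfold psiM
  rw [hp.primeFactors, Finset.filter_singleton]
  split_ifs <;> simp_all

/-- The function `n ↦ μ(n)/ψ_m(n)` restricted to the integers coprime to `k`. -/
noncomputable def mobPsi (m k : ℕ) : ArithmeticFunction ℝ :=
  ⟨fun n => if n.Coprime k then (ArithmeticFunction.moebius n : ℝ) / psiM m n else 0, by simp⟩

lemma mobPsi_apply (m k n : ℕ) : mobPsi m k n =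
  if n.Coprime k then (ArithmeticFunction.moebius n : ℝ) / psiM m n else 0 := rfl

lemma isMultiplicative_mobPsi (m k : ℕ) : (mobPsi m k).IsMultiplicative := by
  refine ⟨by simp [mobPsi_apply, psiM_one], fun {a b} h => ?_⟩
  simp only [mobPsi_apply, Nat.coprime_mul_iff_left, psiM_mul h,
    ArithmeticFunction.isMultiplicative_moebius.map_mul_of_coprime h]
  by_cases h1 : a.Coprime k
  · by_cases h2 : b.Coprime k
    · rw [if_pos ⟨h1, h2⟩, if_pos h1, if_pos h2]
      push_cast
      rw [mul_div_mul_comm]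
    · rw [if_neg (fun h => h2 h.2), if_neg h2, mul_zero]
  · rw [if_neg (fun h => h1 h.1), if_neg h1, zero_mul]

/-- The local weight `|1 + p a(p)|` for `a = mobPsi m k`. -/
noncomputable def locWeight (m k p : ℕ) : ℝ := |1 + p * mobPsi m k p|

lemma abs_mobPsi_mul_invId_prime_pow (m k : ℕ) {p : ℕ} (hp : p.Prime) (i : ℕ) :
    |(mobPsi m k * ArithmeticFunction.invId) (p ^ (i + 1))| =
      locWeight m k p / (p : ℝ) ^ (i + 1) := by
  have hp0 : (0 : ℝ) < p := by exact_mod_cast hp.pos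
  rw [ArithmeticFunction.mul_apply_prime_pow _ _ hp, Finset.sum_range_succ',
    Finset.sum_range_succ', Finset.sum_eq_zero (fun j _ => by
      simp [mobPsi_apply,
        ArithmeticFunction.moebius_apply_prime_pow hp (by omega : j + 1 + 1 ≠ 0)])]
  rw [zero_add, pow_zero, (isMultiplicative_mobPsi m k).map_one, locWeight, eq_div_iff
    (by positivity), ← abs_of_pos (by positivity : (0 : ℝ) < (p : ℝ) ^ (i + 1)), ← abs_mul]
  simp only [zero_add, pow_one, ArithmeticFunction.invId_apply, tsub_zero,
    add_tsub_cancel_right]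
  push_cast
  congr 1
  rw [pow_succ]
  field_simp
  ring

lemma locWeight_le (m k : ℕ) {p : ℕ} (hp : p.Prime) :
    locWeight m k p ≤ if p ∣ m then (p : ℝ) else if p ∣ k then 1 else 1 / p := by
  have hp0 : (0 : ℝ) < p := by exact_mod_cast hp.pos
  have hp1 : (1 : ℝ) ≤ p := by exact_mod_cast hp.one_le
  unfold locWeight
  simp only [mobPsi_apply, psiM_prime hp, hp.coprime_iff_not_dvd,
    ArithmeticFunction.moebius_apply_prime hp]
  by_cases hk : p ∣ k <;> by_cases hm : p ∣ m <;> simp [hk, hm]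
  · exact hp.one_le
  · rw [abs_le]; constructor <;> linarith
  · rw [show 1 + (p : ℝ) * (-1 / (p + 1)) = ((p : ℝ) + 1)⁻¹ by field_simp; ring,
      abs_of_pos (by positivity)]
    gcongr
    linarith

lemma sum_Ioc_le_prod_primesBelow {f : ℕ → ℝ} (h1 : f 1 = 1) (h0 : ∀ n, 0 ≤ f n)
    (hmul : ∀ {a b : ℕ}, a.Coprime b → f (a * b) = f a * f b) {c : ℕ → ℝ}
    (hs : ∀ {p : ℕ}, p.Prime → Summable fun n : ℕ => f (p ^ n))
    (hc : ∀ {p : ℕ}, p.Prime → ∑' n : ℕ, f (p ^ n) ≤ 1 + c p) (N : ℕ) :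
    ∑ n ∈ Ioc 0 N, f n ≤ ∏ p ∈ (N + 1).primesBelow, (1 + c p) := by
  have key := EulerProduct.summable_and_hasSum_smoothNumbers_prod_primesBelow_tsum (f := f) h1
    hmul (fun hp => by simpa only [Real.norm_of_nonneg (h0 _)] using hs hp) (N + 1)
  have hmem : ∀ n ∈ Ioc 0 N, n ∈ (N + 1).smoothNumbers := fun n hn => by
    rw [Finset.mem_Ioc] at hn
    exact Nat.mem_smoothNumbers_of_lt hn.1 (by omega)
  calc ∑ n ∈ Ioc 0 N, f n
      = ∑ n ∈ (Ioc 0 N).subtype (· ∈ (N + 1).smoothNumbers), f n := by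
        rw [Finset.sum_subtype_of_mem f hmem]
    _ ≤ ∏ p ∈ (N + 1).primesBelow, ∑' n : ℕ, f (p ^ n) :=
        sum_le_hasSum _ (fun _ _ => h0 _) key.2
    _ ≤ _ := Finset.prod_le_prod (fun p _ => tsum_nonneg fun _ => h0 _)
        fun p hp => hc (Nat.prime_of_mem_primesBelow hp)

lemma prod_ite_le_prod_primeFactors {c : ℕ → ℝ} (hc : ∀ p, 1 ≤ c p) (s : Finset ℕ)
    (hs : ∀ p ∈ s, p.Prime) {k : ℕ} (hk : k ≠ 0) :
    ∏ p ∈ s, (if p ∣ k then c p else 1) ≤ ∏ p ∈ k.primeFactors, c p := by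
  rw [← Finset.prod_filter]
  have hsub : s.filter (· ∣ k) ⊆ k.primeFactors := fun p hp => by
    rw [Finset.mem_filter] at hp
    exact Nat.mem_primeFactors.2 ⟨hs p hp.1, hp.2, hk⟩
  rw [← Finset.prod_sdiff hsub]
  refine le_mul_of_one_le_left (Finset.prod_nonneg fun p _ => by linarith [hc p]) ?_
  calc (1 : ℝ) = ∏ p ∈ k.primeFactors \ s.filter (· ∣ k), 1 := by simp
    _ ≤ _ := Finset.prod_le_prod (fun _ _ => zero_le_one) fun p _ => hc p

lemma prod_one_add_le_exp_tsum {c : ℕ → ℝ} (hc : ∀ n, 0 ≤ c n) (hs : Summable c)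
    (s : Finset ℕ) : ∏ p ∈ s, (1 + c p) ≤ Real.exp (∑' n, c n) := by
  calc ∏ p ∈ s, (1 + c p) ≤ ∏ p ∈ s, Real.exp (c p) :=
        Finset.prod_le_prod (fun p _ => by linarith [hc p])
          fun p _ => by linarith [Real.add_one_le_exp (c p)]
    _ = Real.exp (∑ p ∈ s, c p) := (Real.exp_sum _ _).symm
    _ ≤ _ := Real.exp_le_exp.2 (hs.sum_le_tsum _ fun n _ => hc n)

lemma hasSum_of_geometric_tail {f : ℕ → ℝ} {w x : ℝ} (hx0 : 0 ≤ x) (hx1 : x < 1) (h0 : f 0 = 1)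
    (h : ∀ i, f (i + 1) = w * x ^ (i + 1)) : HasSum f (1 + w * x / (1 - x)) := by
  rw [← hasSum_nat_add_iff' 1]
  simp only [Finset.range_one, Finset.sum_singleton, h0, add_sub_cancel_left, h]
  have := (hasSum_geometric_of_lt_one hx0 hx1).mul_left (w * x)
  rw [div_eq_mul_inv]
  exact this.congr_fun fun i => by ring

lemma two_rpow_neg_le : (2 : ℝ) ^ (-(7 / 8) : ℝ) ≤ 2 / 3 := by
  have h : ((2 : ℝ) ^ (-(7 / 8) : ℝ)) ^ 8 = 1 / 128 := by
    rw [← Real.rpow_natCast, ← Real.rpow_mul (by norm_num),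
      show (-(7 / 8) * ((8 : ℕ) : ℝ) : ℝ) = -((7 : ℕ) : ℝ) by norm_num,
      Real.rpow_neg (by norm_num), Real.rpow_natCast]
    norm_num
  refine le_of_pow_le_pow_left₀ (by norm_num : 8 ≠ 0) (by norm_num) ?_
  rw [h]; norm_num

lemma one_add_locWeight_le (m k : ℕ) {p : ℕ} (hp : p.Prime) :
    1 + 3 * (locWeight m k p * (p : ℝ) ^ (-(7 / 8) : ℝ)) ≤
      (1 + 3 * (p : ℝ) ^ (-(15 / 8) : ℝ)) *
        (if p ∣ k then 1 + 3 * (p : ℝ) ^ (-(7 / 8) : ℝ) else 1) *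
        (if p ∣ m then 1 + 3 * (p : ℝ) ^ (1 / 8 : ℝ) else 1) := by
  have hp0 : (0 : ℝ) < p := by exact_mod_cast hp.pos
  have hw := mul_le_mul_of_nonneg_right (locWeight_le m k hp)
    (by positivity : 0 ≤ (p : ℝ) ^ (-(7 / 8) : ℝ))
  have e1 : (p : ℝ) * (p : ℝ) ^ (-(7 / 8) : ℝ) = (p : ℝ) ^ (1 / 8 : ℝ) := by
    rw [← Real.rpow_one_add' hp0.le (by norm_num)]; norm_num
  have e2 : 1 / (p : ℝ) * (p : ℝ) ^ (-(7 / 8) : ℝ) = (p : ℝ) ^ (-(15 / 8) : ℝ) := by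
    rw [one_div, ← Real.rpow_neg_one, ← Real.rpow_add hp0]; norm_num
  have g1 : 0 < (p : ℝ) ^ (1 / 8 : ℝ) := by positivity
  have g2 : 0 < (p : ℝ) ^ (-(7 / 8) : ℝ) := by positivity
  have g3 : 0 < (p : ℝ) ^ (-(15 / 8) : ℝ) := by positivity
  generalize (p : ℝ) ^ (1 / 8 : ℝ) = x at *
  generalize (p : ℝ) ^ (-(7 / 8) : ℝ) = y at *
  generalize (p : ℝ) ^ (-(15 / 8) : ℝ) = z at *
  have g4 := mul_pos g1 g2
  have g5 := mul_pos g2 g3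
  have g6 := mul_pos g1 g3
  have g7 := mul_pos g4 g3
  split_ifs at hw ⊢ <;> nlinarith

set_option maxHeartbeats 1000000 in
lemma sum_abs_mobPsi_mul_invId_le : ∃ C > 0, ∀ m k N : ℕ, m ≠ 0 → k ≠ 0 →
    ∑ n ∈ Ioc 0 N, |(mobPsi m k * ArithmeticFunction.invId) n| * (n : ℝ) ^ (1 / 8 : ℝ) ≤
      C * (∏ p ∈ k.primeFactors, (1 + 3 * (p : ℝ) ^ (-(7 / 8) : ℝ))) *
        ∏ p ∈ m.primeFactors, (1 + 3 * (p : ℝ) ^ (1 / 8 : ℝ)) := by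
  have hsum : Summable fun n : ℕ => 3 * (n : ℝ) ^ (-(15 / 8) : ℝ) :=
    (Real.summable_nat_rpow.2 (by norm_num)).mul_left 3
  refine ⟨Real.exp (∑' n : ℕ, 3 * (n : ℝ) ^ (-(15 / 8) : ℝ)), Real.exp_pos _,
    fun m k N hm hk => ?_⟩
  set r := mobPsi m k * ArithmeticFunction.invId with hr
  have hrm : r.IsMultiplicative :=
    (isMultiplicative_mobPsi m k).mul ArithmeticFunction.isMultiplicative_invId
  have hpow : ∀ {p : ℕ}, p.Prime → HasSum
      (fun n : ℕ => |r (p ^ n)| * ((p ^ n : ℕ) : ℝ) ^ (1 / 8 : ℝ))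
      (1 + locWeight m k p * (p : ℝ) ^ (-(7 / 8) : ℝ) / (1 - (p : ℝ) ^ (-(7 / 8) : ℝ))) := by
    intro p hp
    have hp0 : (0 : ℝ) < p := by exact_mod_cast hp.pos
    refine hasSum_of_geometric_tail (by positivity)
      (Real.rpow_lt_one_of_one_lt_of_neg (by exact_mod_cast hp.one_lt) (by norm_num))
      (by simp [hrm.map_one]) fun i => ?_
    rw [hr, abs_mobPsi_mul_invId_prime_pow m k hp, ← Real.rpow_natCast _ (i + 1),
      ← Real.rpow_natCast _ (i + 1), Nat.cast_pow, ← Real.rpow_natCast, ← Real.rpow_mul hp0.le,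
      ← Real.rpow_mul hp0.le, div_mul_eq_mul_div, mul_div_assoc, ← Real.rpow_sub hp0]
    congr 2
    ring
  have hle : ∀ {p : ℕ}, p.Prime →
      1 + locWeight m k p * (p : ℝ) ^ (-(7 / 8) : ℝ) / (1 - (p : ℝ) ^ (-(7 / 8) : ℝ)) ≤
      1 + 3 * (locWeight m k p * (p : ℝ) ^ (-(7 / 8) : ℝ)) := by
    intro p hp
    have hp0 : (0 : ℝ) < p := by exact_mod_cast hp.pos
    have h2 : (p : ℝ) ^ (-(7 / 8) : ℝ) ≤ 2 / 3 := le_trans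
      (Real.rpow_le_rpow_of_nonpos (by norm_num) (by exact_mod_cast hp.two_le) (by norm_num))
      two_rpow_neg_le
    have h3 : 0 ≤ locWeight m k p * (p : ℝ) ^ (-(7 / 8) : ℝ) :=
      mul_nonneg (abs_nonneg _) (by positivity)
    rw [add_le_add_iff_left, div_le_iff₀ (by linarith)]
    nlinarith
  refine (sum_Ioc_le_prod_primesBelow (by simp [hrm.map_one]) (fun n => by positivity)
    (fun {a b} hab => ?_) (fun hp => (hpow hp).summable)
    (fun hp => (hpow hp).tsum_eq.trans_le (hle hp)) N).trans ?_
  · rw [hrm.map_mul_of_coprime hab, abs_mul, Nat.cast_mul,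
      Real.mul_rpow (by positivity) (by positivity)]
    ring
  have hprime : ∀ p ∈ (N + 1).primesBelow, p.Prime := fun p => Nat.prime_of_mem_primesBelow
  calc
    _ ≤ ∏ p ∈ (N + 1).primesBelow, ((1 + 3 * (p : ℝ) ^ (-(15 / 8) : ℝ)) *
          (if p ∣ k then 1 + 3 * (p : ℝ) ^ (-(7 / 8) : ℝ) else 1) *
          (if p ∣ m then 1 + 3 * (p : ℝ) ^ (1 / 8 : ℝ) else 1)) := by
      refine Finset.prod_le_prod (fun p _ => ?_) fun p hp => ?_
      · have : 0 ≤ locWeight m k p := abs_nonneg _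
        positivity
      · exact one_add_locWeight_le m k (hprime p hp)
    _ = (∏ p ∈ (N + 1).primesBelow, (1 + 3 * (p : ℝ) ^ (-(15 / 8) : ℝ))) *
          (∏ p ∈ (N + 1).primesBelow, (if p ∣ k then 1 + 3 * (p : ℝ) ^ (-(7 / 8) : ℝ) else 1)) *
          ∏ p ∈ (N + 1).primesBelow, (if p ∣ m then 1 + 3 * (p : ℝ) ^ (1 / 8 : ℝ) else 1) := by
      rw [Finset.prod_mul_distrib, Finset.prod_mul_distrib]
    _ ≤ _ := by
      have h1 := prod_one_add_le_exp_tsum (fun n => by positivity) hsum (N + 1).primesBelow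
      have h2 := prod_ite_le_prod_primeFactors (c := fun p => 1 + 3 * (p : ℝ) ^ (-(7 / 8) : ℝ))
        (fun p => by simp; positivity) (N + 1).primesBelow hprime hk
      have h3 := prod_ite_le_prod_primeFactors (c := fun p => 1 + 3 * (p : ℝ) ^ (1 / 8 : ℝ))
        (fun p => by simp; positivity) (N + 1).primesBelow hprime hm
      refine mul_le_mul (mul_le_mul h1 h2 ?_ (Real.exp_pos _).le) h3 ?_ ?_
      · exact Finset.prod_nonneg fun p _ => by split_ifs <;> positivity
      · exact Finset.prod_nonneg fun p _ => by split_ifs <;> positivity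
      · positivity

lemma one_add_log_rpow_neg_div_le {v e : ℝ} (he : 1 ≤ e) (hv : e ≤ v) :
    (1 + Real.log (v / e)) ^ (-(2 / 3) : ℝ) ≤
      (1 + Real.log v) ^ (-(2 / 3) : ℝ) * (8 * e ^ (1 / 8 : ℝ)) := by
  have he0 : 0 < e := by linarith
  have hl1 : 0 ≤ Real.log (v / e) := Real.log_nonneg ((one_le_div he0).2 hv)
  have hl2 : 0 ≤ Real.log e := Real.log_nonneg he
  have hl : Real.log v = Real.log (v / e) + Real.log e := by
    rw [Real.log_div (by linarith) he0.ne']; ring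
  have hprod : 1 + Real.log v ≤ (1 + Real.log (v / e)) * (1 + Real.log e) := by
    rw [hl]; nlinarith [mul_nonneg hl1 hl2]
  have hlog : 1 + Real.log e ≤ 8 * e ^ (1 / 8 : ℝ) := by
    have := Real.log_le_sub_one_of_pos (by positivity : 0 < e ^ (1 / 8 : ℝ))
    rw [Real.log_rpow he0] at this
    linarith
  have h1 : (1 + Real.log e) ^ (2 / 3 : ℝ) ≤ 8 * e ^ (1 / 8 : ℝ) :=
    (Real.rpow_le_self_of_one_le (by linarith) (by norm_num)).trans hlog
  have h2 := Real.rpow_le_rpow (by linarith) hprod (by norm_num : (0 : ℝ) ≤ 2 / 3)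
  rw [Real.mul_rpow (by linarith) (by linarith)] at h2
  have hv0 : 0 < 1 + Real.log v := by linarith
  rw [Real.rpow_neg (by linarith), Real.rpow_neg hv0.le, inv_mul_eq_div,
    le_div_iff₀ (by positivity), inv_mul_le_iff₀ (by positivity)]
  refine h2.trans ?_
  gcongr

lemma sq_sum_mobPsi_le : ∃ C > 0, ∀ m k v : ℕ, m ≠ 0 → k ≠ 0 → 1 ≤ v →
    (∑ n ∈ Ioc 0 v, mobPsi m k n) ^ 2 ≤
      C * (∏ p ∈ m.primeFactors, 16 * (p : ℝ) ^ (1 / 4 : ℝ)) *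
        (∏ p ∈ k.primeFactors, (1 + 15 * (p : ℝ) ^ (-(7 / 8) : ℝ))) *
        (1 + Real.log v) ^ (-(4 / 3) : ℝ) := by
  obtain ⟨C₁, hC₁, H₁⟩ := abs_mobSum_le_rpow
  obtain ⟨C₂, hC₂, H₂⟩ := sum_abs_mobPsi_mul_invId_le
  refine ⟨(8 * C₁ * C₂) ^ 2, by positivity, fun m k v hm hk hv => ?_⟩
  set r := mobPsi m k * ArithmeticFunction.invId with hr
  have hv1 : (1 : ℝ) ≤ v := by exact_mod_cast hv
  have hlv : 0 ≤ Real.log v := Real.log_nonneg hv1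
  have hbound : |∑ n ∈ Ioc 0 v, mobPsi m k n| ≤ 8 * C₁ * C₂ *
      (∏ p ∈ k.primeFactors, (1 + 3 * (p : ℝ) ^ (-(7 / 8) : ℝ))) *
      (∏ p ∈ m.primeFactors, (1 + 3 * (p : ℝ) ^ (1 / 8 : ℝ))) *
      (1 + Real.log v) ^ (-(2 / 3) : ℝ) := by
    rw [← ArithmeticFunction.mul_invId_mul_mobInvId (mobPsi m k),
      ArithmeticFunction.sum_Ioc_mul_eq_sum_sum]
    calc
      _ ≤ ∑ n ∈ Ioc 0 v, |r n * ∑ j ∈ Ioc 0 (v / n), ArithmeticFunction.mobInvId j| :=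
        Finset.abs_sum_le_sum_abs _ _
      _ ≤ ∑ n ∈ Ioc 0 v, (8 * C₁ * (1 + Real.log v) ^ (-(2 / 3) : ℝ)) *
            (|r n| * (n : ℝ) ^ (1 / 8 : ℝ)) := by
        refine Finset.sum_le_sum fun n hn => ?_
        rw [Finset.mem_Ioc] at hn
        have hn1 : (1 : ℝ) ≤ n := by exact_mod_cast hn.1
        have hnv : (n : ℝ) ≤ v := by exact_mod_cast hn.2
        have hm1 : ∑ j ∈ Ioc 0 (v / n), ArithmeticFunction.mobInvId j =
            mobSum ((v : ℝ) / n) := by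
          rw [mobSum, Nat.floor_div_natCast, Nat.floor_natCast]
          rfl
        have h1 := (H₁ ((v : ℝ) / n) ((one_le_div (by linarith)).2 hnv)).trans
          (mul_le_mul_of_nonneg_left (one_add_log_rpow_neg_div_le hn1 hnv) hC₁.le)
        rw [abs_mul, hm1]
        calc _ ≤ |r n| * _ := mul_le_mul_of_nonneg_left h1 (abs_nonneg _)
          _ = _ := by ring
      _ ≤ _ := by
        rw [← Finset.mul_sum]
        calc _ ≤ (8 * C₁ * (1 + Real.log v) ^ (-(2 / 3) : ℝ)) * _ :=
              mul_le_mul_of_nonneg_left (H₂ m k v hm hk) (by positivity)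
          _ = _ := by ring
  have hsq := pow_le_pow_left₀ (abs_nonneg _) hbound 2
  rw [sq_abs] at hsq
  refine hsq.trans ?_
  rw [mul_pow, mul_pow, mul_pow, ← Finset.prod_pow, ← Finset.prod_pow,
    ← Real.rpow_natCast (_ ^ _) 2, ← Real.rpow_mul (by linarith)]
  have e : (-(2 / 3) * ((2 : ℕ) : ℝ) : ℝ) = -(4 / 3) := by norm_num
  rw [e]
  have hA : ∏ p ∈ k.primeFactors, (1 + 3 * (p : ℝ) ^ (-(7 / 8) : ℝ)) ^ 2 ≤
      ∏ p ∈ k.primeFactors, (1 + 15 * (p : ℝ) ^ (-(7 / 8) : ℝ)) := by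
    refine Finset.prod_le_prod (fun p _ => by positivity) fun p hp => ?_
    have hx : (p : ℝ) ^ (-(7 / 8) : ℝ) ≤ 1 := Real.rpow_le_one_of_one_le_of_nonpos
      (by exact_mod_cast (Nat.prime_of_mem_primeFactors hp).one_le) (by norm_num)
    have hx0 : 0 ≤ (p : ℝ) ^ (-(7 / 8) : ℝ) := by positivity
    nlinarith
  have hB : ∏ p ∈ m.primeFactors, (1 + 3 * (p : ℝ) ^ (1 / 8 : ℝ)) ^ 2 ≤
      ∏ p ∈ m.primeFactors, 16 * (p : ℝ) ^ (1 / 4 : ℝ) := by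
    refine Finset.prod_le_prod (fun p _ => by positivity) fun p hp => ?_
    have hx : 1 ≤ (p : ℝ) ^ (1 / 8 : ℝ) := Real.one_le_rpow
      (by exact_mod_cast (Nat.prime_of_mem_primeFactors hp).one_le) (by norm_num)
    have hx2 : (p : ℝ) ^ (1 / 4 : ℝ) = ((p : ℝ) ^ (1 / 8 : ℝ)) ^ 2 := by
      rw [← Real.rpow_natCast, ← Real.rpow_mul (by positivity)]; norm_num
    rw [hx2]
    nlinarith
  calc _ ≤ (8 * C₁ * C₂) ^ 2 * (∏ p ∈ k.primeFactors, (1 + 15 * (p : ℝ) ^ (-(7 / 8) : ℝ))) *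
        (∏ p ∈ m.primeFactors, 16 * (p : ℝ) ^ (1 / 4 : ℝ)) *
        (1 + Real.log v) ^ (-(4 / 3) : ℝ) := by gcongr
    _ = _ := by ring

lemma exists_prod_le_sqrt_psi : ∃ C > 0, ∀ m : ℕ,
    ∏ p ∈ m.primeFactors, 16 * (p : ℝ) ^ (1 / 4 : ℝ) ≤ C * Real.sqrt (psi m) := by
  obtain ⟨K, hK⟩ : ∃ K : ℕ, ∀ n : ℕ, K ≤ n → 16 ≤ (n : ℝ) ^ (1 / 4 : ℝ) := by
    have h := (tendsto_rpow_atTop (by norm_num : (0 : ℝ) < 1 / 4)).comp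
      (tendsto_natCast_atTop_atTop (R := ℝ))
    exact eventually_atTop.1 (h.eventually_ge_atTop 16)
  refine ⟨16 ^ K, by positivity, fun m => ?_⟩
  have hpsi : Real.sqrt (psi m) = ∏ p ∈ m.primeFactors, Real.sqrt ((p : ℝ) + 1) := by
    rw [psi, Nat.cast_prod, Real.sqrt_prod _ fun p _ => by positivity]
    push_cast
    rfl
  have hfac : ∏ p ∈ m.primeFactors, (if p < K then (16 : ℝ) else 1) ≤ 16 ^ K := by
    rw [← Finset.prod_filter, Finset.prod_const]
    refine pow_le_pow_right₀ (by norm_num) ?_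
    calc (m.primeFactors.filter (· < K)).card ≤ (Finset.range K).card :=
          Finset.card_le_card fun p hp => by
            rw [Finset.mem_filter] at hp
            exact Finset.mem_range.2 hp.2
      _ = K := Finset.card_range K
  calc
    _ ≤ ∏ p ∈ m.primeFactors, (if p < K then (16 : ℝ) else 1) * Real.sqrt ((p : ℝ) + 1) := by
      refine Finset.prod_le_prod (fun p _ => by positivity) fun p hp => ?_
      have hp1 : (1 : ℝ) ≤ p := by exact_mod_cast (Nat.prime_of_mem_primeFactors hp).one_le
      have h1 : (p : ℝ) ^ (1 / 2 : ℝ) ≤ Real.sqrt ((p : ℝ) + 1) := by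
        rw [← Real.sqrt_eq_rpow]
        exact Real.sqrt_le_sqrt (by linarith)
      split_ifs with h
      · refine mul_le_mul_of_nonneg_left (le_trans ?_ h1) (by norm_num)
        exact Real.rpow_le_rpow_of_exponent_le hp1 (by norm_num)
      · rw [one_mul]
        refine le_trans ?_ h1
        have h2 : (p : ℝ) ^ (1 / 2 : ℝ) = (p : ℝ) ^ (1 / 4 : ℝ) * (p : ℝ) ^ (1 / 4 : ℝ) := by
          rw [← Real.rpow_add (by linarith)]; norm_num
        rw [h2]
        exact mul_le_mul_of_nonneg_right (hK p (not_lt.1 h)) (by positivity)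
    _ = (∏ p ∈ m.primeFactors, if p < K then (16 : ℝ) else 1) * Real.sqrt (psi m) := by
      rw [Finset.prod_mul_distrib, hpsi]
    _ ≤ _ := mul_le_mul_of_nonneg_right hfac (Real.sqrt_nonneg _)

lemma sum_Ioc_sum_divisors (F : ℕ → ℕ → ℝ) (N : ℕ) :
    ∑ k ∈ Ioc 0 N, ∑ j ∈ k.divisors, F j k =
      ∑ j ∈ Ioc 0 N, ∑ l ∈ Ioc 0 (N / j), F j (j * l) := by
  rw [Finset.sum_sigma', Finset.sum_sigma']
  refine Finset.sum_bij' (fun x _ => ⟨x.2, x.1 / x.2⟩) (fun x _ => ⟨x.1 * x.2, x.1⟩) ?_ ?_ ?_ ?_ ?_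
  · rintro ⟨k, j⟩ h
    simp only [Finset.mem_sigma, Finset.mem_Ioc, Nat.mem_divisors] at h ⊢
    have hj := Nat.pos_of_dvd_of_pos h.2.1 h.1.1
    have hjk := Nat.le_of_dvd h.1.1 h.2.1
    exact ⟨⟨hj, hjk.trans h.1.2⟩, Nat.div_pos hjk hj, Nat.div_le_div_right h.1.2⟩
  · rintro ⟨j, l⟩ h
    simp only [Finset.mem_sigma, Finset.mem_Ioc, Nat.mem_divisors] at h ⊢
    have h1 := (Nat.le_div_iff_mul_le h.1.1).1 h.2.2
    have h2 := Nat.mul_pos h.1.1 h.2.1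
    exact ⟨⟨h2, by rwa [mul_comm]⟩, Dvd.intro _ rfl, h2.ne'⟩
  · rintro ⟨k, j⟩ h
    simp only [Finset.mem_sigma, Nat.mem_divisors] at h
    simp [Nat.mul_div_cancel' h.2.1]
  · rintro ⟨j, l⟩ h
    simp only [Finset.mem_sigma, Finset.mem_Ioc] at h
    simp [Nat.mul_div_cancel_left _ h.1.1]
  · rintro ⟨k, j⟩ h
    simp only [Finset.mem_sigma, Nat.mem_divisors] at h
    simp [Nat.mul_div_cancel' h.2.1]

lemma sub_mul_rpow_le {a b : ℝ} (hb : 0 < b) (hab : b ≤ a) :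
    (a - b) * a ^ (-(4 / 3) : ℝ) ≤ 3 * (b ^ (-(1 / 3) : ℝ) - a ^ (-(1 / 3) : ℝ)) := by
  have ha : 0 < a := hb.trans_le hab
  set s := a ^ (1 / 3 : ℝ) with hs
  set t := b ^ (1 / 3 : ℝ) with ht
  have hs0 : 0 < s := by positivity
  have ht0 : 0 < t := by positivity
  have hst : t ≤ s := Real.rpow_le_rpow hb.le hab (by norm_num)
  have e1 : a = s ^ 3 := by
    rw [hs, ← Real.rpow_natCast, ← Real.rpow_mul ha.le]; norm_num
  have e2 : b = t ^ 3 := by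
    rw [ht, ← Real.rpow_natCast, ← Real.rpow_mul hb.le]; norm_num
  have e3 : a ^ (-(4 / 3) : ℝ) = (s ^ 4)⁻¹ := by
    rw [hs, ← Real.rpow_natCast, ← Real.rpow_mul ha.le, ← Real.rpow_neg ha.le]; norm_num
  rw [e3, Real.rpow_neg ha.le, Real.rpow_neg hb.le, ← hs, ← ht]
  have e4 : 3 * (t⁻¹ - s⁻¹) = 3 * (s - t) * s ^ 3 / t * (s ^ 4)⁻¹ := by
    field_simp
  rw [e4]
  refine mul_le_mul_of_nonneg_right ?_ (by positivity)
  rw [le_div_iff₀ ht0]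
  nth_rewrite 1 [e1]
  rw [e2]
  have h1 : t * (s ^ 2 + s * t + t ^ 2) ≤ 3 * s ^ 3 := by
    nlinarith [mul_nonneg (sub_nonneg.2 hst) hs0.le, mul_pos hs0 ht0, sq_nonneg (s - t),
      mul_nonneg (sub_nonneg.2 hst) (sq_nonneg s), mul_nonneg (sub_nonneg.2 hst) (sq_nonneg t),
      mul_nonneg (sub_nonneg.2 hst) (mul_pos hs0 ht0).le]
  nlinarith [mul_le_mul_of_nonneg_left h1 (sub_nonneg.2 hst)]

lemma sum_inv_mul_log_rpow_le {z : ℝ} (hz : 1 ≤ z) (L : ℕ) (hL : (L : ℝ) ≤ z) :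
    ∑ l ∈ Ioc 0 L, 1 / (l : ℝ) * (1 + Real.log (z / l)) ^ (-(4 / 3) : ℝ) ≤
      6 * (1 + Real.log (z / (L + 1))) ^ (-(1 / 3) : ℝ) := by
  have hlog2 : Real.log 2 < 1 := by linarith [Real.log_two_lt_d9]
  have hpos : ∀ x : ℝ, 0 < x → x ≤ 2 * z → 0 < 1 + Real.log (z / x) := by
    intro x hx hxz
    have h1 : Real.log (1 / 2) ≤ Real.log (z / x) :=
      Real.log_le_log (by norm_num) (by rw [div_le_div_iff₀ (by norm_num) hx]; linarith)
    rw [one_div, Real.log_inv] at h1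
    linarith
  induction L with
  | zero =>
    simp only [Finset.Ioc_self, Finset.sum_empty]
    have := hpos 1 one_pos (by linarith)
    simp only [Nat.cast_zero, zero_add]
    positivity
  | succ L ih =>
    push_cast at hL ⊢
    have hL0 : (0 : ℝ) ≤ L := Nat.cast_nonneg _
    rw [Finset.sum_Ioc_succ_top (Nat.zero_le _)]
    have h1 := ih (by linarith)
    have ha := hpos (L + 1) (by linarith) (by linarith)
    have hb := hpos (L + 1 + 1) (by linarith) (by linarith)
    have hd : (1 + Real.log (z / (L + 1))) - (1 + Real.log (z / (L + 1 + 1))) =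
        -Real.log ((L + 1) / (L + 1 + 1)) := by
      rw [Real.log_div (by linarith) (by linarith), Real.log_div (by linarith) (by linarith),
        Real.log_div (by linarith) (by linarith)]
      ring
    have hd2 : 1 / (2 * ((L : ℝ) + 1)) ≤ -Real.log (((L : ℝ) + 1) / (L + 1 + 1)) := by
      have h2 := Real.log_le_sub_one_of_pos
        (by positivity : 0 < ((L : ℝ) + 1) / (L + 1 + 1))
      have h3 : 1 - ((L : ℝ) + 1) / (L + 1 + 1) = 1 / (L + 1 + 1) := by field_simp; ring
      have h4 : 1 / (2 * ((L : ℝ) + 1)) ≤ 1 / (L + 1 + 1) := by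
        gcongr
        linarith
      linarith
    have hd3 : 0 < 1 / (2 * ((L : ℝ) + 1)) := by positivity
    have h5 := sub_mul_rpow_le hb (a := 1 + Real.log (z / (L + 1))) (by linarith)
    rw [hd] at h5
    have h6 := mul_le_mul_of_nonneg_right hd2
      (by positivity : 0 ≤ (1 + Real.log (z / (L + 1))) ^ (-(4 / 3) : ℝ))
    have h7 : 1 / (2 * ((L : ℝ) + 1)) = 1 / ((L : ℝ) + 1) / 2 := by
      rw [div_div, mul_comm]
    rw [h7] at h6
    push_cast
    linarith

/-- The majorant `∏_{p ∣ k} (1 + 15 p^{-7/8})` of the dependence on `k` in `sq_sum_mobPsi_le`. -/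
noncomputable def gProd (k : ℕ) : ℝ := ∏ p ∈ k.primeFactors, (1 + 15 * (p : ℝ) ^ (-(7 / 8) : ℝ))

/-- The function `j ↦ ∏_{p ∣ j} 15 p^{-7/8}`. -/
noncomputable def hProd : ArithmeticFunction ℝ :=
  ArithmeticFunction.prodPrimeFactors fun p => 15 * (p : ℝ) ^ (-(7 / 8) : ℝ)

lemma hProd_nonneg (j : ℕ) : 0 ≤ hProd j := by
  rcases eq_or_ne j 0 with rfl | hj
  · simp
  · rw [hProd, ArithmeticFunction.prodPrimeFactors_apply hj]
    positivity

lemma hProd_prime_pow {p : ℕ} (hp : p.Prime) (i : ℕ) :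
    hProd (p ^ (i + 1)) = 15 * (p : ℝ) ^ (-(7 / 8) : ℝ) := by
  rw [hProd, ArithmeticFunction.prodPrimeFactors_apply (pow_ne_zero _ hp.ne_zero),
    Nat.primeFactors_prime_pow (by omega) hp, Finset.prod_singleton]

lemma gProd_eq_sum_divisors {k : ℕ} (hk : Squarefree k) : gProd k = ∑ j ∈ k.divisors, hProd j := by
  rw [← (ArithmeticFunction.IsMultiplicative.prodPrimeFactors
    _).prodPrimeFactors_one_add_of_squarefree hk, gProd]
  refine Finset.prod_congr rfl fun p hp => ?_
  have h := hProd_prime_pow (Nat.prime_of_mem_primeFactors hp) 0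
  rw [zero_add, pow_one] at h
  rw [h]

lemma exists_sum_hProd_div_le : ∃ H > 0, ∀ N : ℕ, ∑ j ∈ Ioc 0 N, hProd j / j ≤ H := by
  have hsum : Summable fun n : ℕ => 30 * (n : ℝ) ^ (-(15 / 8) : ℝ) :=
    (Real.summable_nat_rpow.2 (by norm_num)).mul_left 30
  refine ⟨Real.exp (∑' n : ℕ, 30 * (n : ℝ) ^ (-(15 / 8) : ℝ)), Real.exp_pos _, fun N => ?_⟩
  have hm : hProd.IsMultiplicative := ArithmeticFunction.IsMultiplicative.prodPrimeFactors _
  have hpow : ∀ {p : ℕ}, p.Prime → HasSum (fun n : ℕ => hProd (p ^ n) / ((p ^ n : ℕ) : ℝ))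
      (1 + 15 * (p : ℝ) ^ (-(7 / 8) : ℝ) * (1 / p) / (1 - 1 / p)) := by
    intro p hp
    have hp1 : (1 : ℝ) < p := by exact_mod_cast hp.one_lt
    refine hasSum_of_geometric_tail (by positivity) ((div_lt_one (by linarith)).2 hp1)
      (by simp [hm.map_one]) fun i => ?_
    rw [hProd_prime_pow hp]
    push_cast
    rw [one_div_pow, mul_one_div]
  refine (sum_Ioc_le_prod_primesBelow (c := fun n => 30 * (n : ℝ) ^ (-(15 / 8) : ℝ))
    (by simp [hm.map_one]) (fun n => div_nonneg (hProd_nonneg n) (Nat.cast_nonneg n))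
    (fun {a b} hab => ?_) (fun hp => (hpow hp).summable)
    (fun {p} hp => (hpow hp).tsum_eq.trans_le ?_) N).trans
      (prod_one_add_le_exp_tsum (fun n => by positivity) hsum _)
  · rw [hm.map_mul_of_coprime hab]
    push_cast
    rw [mul_div_mul_comm]
  · have hp2 : (2 : ℝ) ≤ p := by exact_mod_cast hp.two_le
    have hp0 : (0 : ℝ) < p := by linarith
    have e2 : (p : ℝ) ^ (-(7 / 8) : ℝ) * (1 / p) = (p : ℝ) ^ (-(15 / 8) : ℝ) := by
      rw [one_div, ← Real.rpow_neg_one, ← Real.rpow_add hp0]; norm_num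
    have h2 : 1 / (p : ℝ) ≤ 1 / 2 := by gcongr
    have h3 : 0 < (p : ℝ) ^ (-(15 / 8) : ℝ) := by positivity
    rw [mul_assoc, e2, add_le_add_iff_left, div_le_iff₀ (by linarith)]
    nlinarith

lemma one_add_log_natDiv_rpow_le {Y k : ℕ} (hk : 0 < k) (hkY : k ≤ Y) :
    (1 + Real.log ((Y / k : ℕ) : ℝ)) ^ (-(4 / 3) : ℝ) ≤
      4 * (1 + Real.log ((Y : ℝ) / k)) ^ (-(4 / 3) : ℝ) := by
  have hk0 : (0 : ℝ) < k := by exact_mod_cast hk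
  have h1 : (1 : ℝ) ≤ ((Y / k : ℕ) : ℝ) := by exact_mod_cast Nat.div_pos hkY hk
  have h2 : (Y : ℝ) / k < ((Y / k : ℕ) : ℝ) + 1 := by
    rw [← Nat.floor_div_eq_div (K := ℝ)]
    exact Nat.lt_floor_add_one _
  have h3 : 1 ≤ (Y : ℝ) / k := (one_le_div hk0).2 (by exact_mod_cast hkY)
  have hl1 : 0 ≤ Real.log ((Y / k : ℕ) : ℝ) := Real.log_nonneg h1
  have hl3 : 0 ≤ Real.log ((Y : ℝ) / k) := Real.log_nonneg h3
  have h4 : Real.log ((Y : ℝ) / k) ≤ Real.log 2 + Real.log ((Y / k : ℕ) : ℝ) := by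
    rw [← Real.log_mul (by norm_num) (by linarith)]
    exact Real.log_le_log (by linarith) (by linarith)
  have hlog2 : Real.log 2 < 1 := by linarith [Real.log_two_lt_d9]
  have h5 : (1 + Real.log ((Y : ℝ) / k)) / 2 ≤ 1 + Real.log ((Y / k : ℕ) : ℝ) := by linarith
  refine (Real.rpow_le_rpow_of_nonpos (by linarith) h5 (by norm_num)).trans ?_
  rw [Real.div_rpow (by linarith) (by norm_num), div_eq_mul_inv, mul_comm,
    ← Real.rpow_neg (by norm_num)]
  refine mul_le_mul_of_nonneg_right ?_ (by positivity)
  calc (2 : ℝ) ^ (-(-(4 / 3)) : ℝ) ≤ (2 : ℝ) ^ (2 : ℝ) :=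
        Real.rpow_le_rpow_of_exponent_le (by norm_num) (by norm_num)
    _ = 4 := by norm_num

lemma exists_sum_gProd_le : ∃ ε : ℕ → ℝ, Tendsto ε atTop (nhds 0) ∧ ∀ U Y : ℕ, 1 ≤ U →
    ∑ k ∈ (Ioc 0 (Y / U)).filter Squarefree,
      gProd k / k * (1 + Real.log ((Y / k : ℕ) : ℝ)) ^ (-(4 / 3) : ℝ) ≤ ε U := by
  obtain ⟨H, hH, hHN⟩ := exists_sum_hProd_div_le
  refine ⟨fun U => 24 * H * (1 + Real.log ((U : ℝ) / 2)) ^ (-(1 / 3) : ℝ), ?_,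
    fun U Y hU => ?_⟩
  · have h1 : Tendsto (fun U : ℕ => 1 + Real.log ((U : ℝ) / 2)) atTop atTop :=
      tendsto_atTop_add_const_left _ _ (Real.tendsto_log_atTop.comp
        (tendsto_natCast_atTop_atTop.atTop_div_const (by norm_num)))
    have h2 := ((tendsto_rpow_neg_atTop (by norm_num : (0 : ℝ) < 1 / 3)).comp h1).const_mul
      (24 * H)
    rw [mul_zero] at h2
    exact h2
  have hU1 : (1 : ℝ) ≤ U := by exact_mod_cast hU
  have hlog2 : Real.log 2 < 1 := by linarith [Real.log_two_lt_d9]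
  have hUpos : 0 < 1 + Real.log ((U : ℝ) / 2) := by
    rw [Real.log_div (by linarith) (by norm_num)]
    linarith [Real.log_nonneg hU1]
  set w : ℕ → ℝ := fun k => (1 + Real.log ((Y : ℝ) / k)) ^ (-(4 / 3) : ℝ) with hw
  have hkY : ∀ k ∈ Ioc 0 (Y / U), 0 < k ∧ k ≤ Y := fun k hk => by
    rw [Finset.mem_Ioc] at hk
    exact ⟨hk.1, hk.2.trans (Nat.div_le_self _ _)⟩
  have hw0 : ∀ k ∈ Ioc 0 (Y / U), 0 ≤ w k := fun k hk => by
    have hk0 : (0 : ℝ) < k := by exact_mod_cast (hkY k hk).1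
    have : 0 ≤ Real.log ((Y : ℝ) / k) :=
      Real.log_nonneg ((one_le_div hk0).2 (by exact_mod_cast (hkY k hk).2))
    positivity
  calc
    _ ≤ ∑ k ∈ (Ioc 0 (Y / U)).filter Squarefree,
          4 * ∑ j ∈ k.divisors, hProd j * (1 / k * w k) := by
      refine Finset.sum_le_sum fun k hk => ?_
      rw [Finset.mem_filter] at hk
      have hk1 := hkY k hk.1
      rw [← Finset.sum_mul, ← gProd_eq_sum_divisors hk.2]
      have hg : 0 ≤ gProd k / k := div_nonneg (Finset.prod_nonneg fun p _ => by positivity)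
        (Nat.cast_nonneg k)
      calc _ ≤ gProd k / k * (4 * w k) :=
            mul_le_mul_of_nonneg_left (one_add_log_natDiv_rpow_le hk1.1 hk1.2) hg
        _ = _ := by ring
    _ ≤ ∑ k ∈ Ioc 0 (Y / U), 4 * ∑ j ∈ k.divisors, hProd j * (1 / k * w k) := by
      refine Finset.sum_le_sum_of_subset_of_nonneg (Finset.filter_subset _ _) fun k hk _ => ?_
      have := hw0 k hk
      exact mul_nonneg (by norm_num) (Finset.sum_nonneg fun j _ =>
        mul_nonneg (hProd_nonneg j) (by positivity))
    _ = 4 * ∑ j ∈ Ioc 0 (Y / U), ∑ l ∈ Ioc 0 (Y / U / j),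
          hProd j * (1 / ((j * l : ℕ) : ℝ) * w (j * l)) := by
      rw [← Finset.mul_sum, sum_Ioc_sum_divisors fun j k => hProd j * (1 / (k : ℝ) * w k)]
    _ ≤ 4 * ∑ j ∈ Ioc 0 (Y / U),
          hProd j / j * (6 * (1 + Real.log ((U : ℝ) / 2)) ^ (-(1 / 3) : ℝ)) := by
      refine mul_le_mul_of_nonneg_left (Finset.sum_le_sum fun j hj => ?_) (by norm_num)
      have hj1 := hkY j hj
      have hj0 : (0 : ℝ) < j := by exact_mod_cast hj1.1
      have hz : 1 ≤ (Y : ℝ) / j := (one_le_div hj0).2 (by exact_mod_cast hj1.2)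
      set L := Y / U / j with hL
      have hLU : (L : ℝ) * U ≤ (Y : ℝ) / j := by
        rw [le_div_iff₀ hj0]
        have h1 : L * j ≤ Y / U := Nat.div_mul_le_self _ _
        have h2 : Y / U * U ≤ Y := Nat.div_mul_le_self _ _
        have : L * U * j ≤ Y := by nlinarith
        exact_mod_cast this
      have hLz : (L : ℝ) ≤ (Y : ℝ) / j :=
        le_trans (le_mul_of_one_le_right (Nat.cast_nonneg L) hU1) hLU
      have hsum : ∑ l ∈ Ioc 0 L, 1 / (l : ℝ) * (1 + Real.log ((Y : ℝ) / j / l)) ^ (-(4 / 3) : ℝ) ≤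
          6 * (1 + Real.log ((U : ℝ) / 2)) ^ (-(1 / 3) : ℝ) := by
        rcases Nat.eq_zero_or_pos L with h0 | h0
        · rw [h0, Finset.Ioc_self, Finset.sum_empty]
          positivity
        · refine (sum_inv_mul_log_rpow_le hz L hLz).trans ?_
          have hL1 : (1 : ℝ) ≤ L := by exact_mod_cast h0
          refine mul_le_mul_of_nonneg_left (Real.rpow_le_rpow_of_nonpos hUpos ?_ (by norm_num))
            (by norm_num)
          gcongr 1 + ?_
          refine Real.log_le_log (by positivity) ?_
          rw [div_le_div_iff₀ (by norm_num) (by positivity)]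
          nlinarith
      calc _ = hProd j / j *
            ∑ l ∈ Ioc 0 L, 1 / (l : ℝ) * (1 + Real.log ((Y : ℝ) / j / l)) ^ (-(4 / 3) : ℝ) := by
            rw [Finset.mul_sum]
            refine Finset.sum_congr rfl fun l _ => ?_
            simp only [hw]
            push_cast
            rw [div_div]
            ring
        _ ≤ _ := mul_le_mul_of_nonneg_left hsum (div_nonneg (hProd_nonneg j) hj0.le)
    _ ≤ _ := by
      rw [← Finset.sum_mul]
      have h1 : 0 ≤ (1 + Real.log ((U : ℝ) / 2)) ^ (-(1 / 3) : ℝ) := by positivity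
      nlinarith [mul_le_mul_of_nonneg_right (hHN (Y / U)) h1]

lemma psi_mul {a b : ℕ} (h : a.Coprime b) : psi (a * b) = psi a * psi b := by
  unfold psi
  rw [h.primeFactors_mul, Finset.prod_union h.disjoint_primeFactors]

lemma psi_pos (n : ℕ) : 0 < psi n := Finset.prod_pos fun _ _ => Nat.succ_pos _

lemma psi_prime {p : ℕ} (hp : p.Prime) : psi p = p + 1 := by
  rw [psi, hp.primeFactors, Finset.prod_singleton]

open Classical in
/-- The function `k ↦ k/ψ(k)²` restricted to the squarefree integers coprime to `n`. -/
noncomputable def gcdWeight (n : ℕ) : ArithmeticFunction ℝ :=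
  ⟨fun k => if k.Coprime n ∧ Squarefree k then (k : ℝ) / (psi k : ℝ) ^ 2 else 0, by simp⟩

open Classical in
lemma gcdWeight_apply (n k : ℕ) : gcdWeight n k =
  if k.Coprime n ∧ Squarefree k then (k : ℝ) / (psi k : ℝ) ^ 2 else 0 := rfl

lemma gcdWeight_nonneg (n k : ℕ) : 0 ≤ gcdWeight n k := by
  rw [gcdWeight_apply]
  split_ifs <;> positivity

lemma isMultiplicative_gcdWeight (n : ℕ) : (gcdWeight n).IsMultiplicative := by
  refine ⟨by simp [gcdWeight_apply, psi], fun {a b} h => ?_⟩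
  simp only [gcdWeight_apply, Nat.coprime_mul_iff_left, Nat.squarefree_mul h, psi_mul h]
  by_cases h1 : a.Coprime n ∧ Squarefree a
  · by_cases h2 : b.Coprime n ∧ Squarefree b
    · rw [if_pos ⟨⟨h1.1, h2.1⟩, h1.2, h2.2⟩, if_pos h1, if_pos h2]
      push_cast
      rw [mul_pow, mul_div_mul_comm]
    · rw [if_neg (fun h => h2 ⟨h.1.2, h.2.2⟩), if_neg h2, mul_zero]
  · rw [if_neg (fun h => h1 ⟨h.1.1, h.2.1⟩), if_neg h1, zero_mul]

lemma gcdWeight_prime (n : ℕ) {p : ℕ} (hp : p.Prime) :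
    gcdWeight n p = if p ∣ n then 0 else (p : ℝ) / ((p : ℝ) + 1) ^ 2 := by
  rw [gcdWeight_apply, psi_prime hp]
  by_cases h : p ∣ n
  · rw [if_neg (fun h' => (hp.coprime_iff_not_dvd.1 h'.1) h), if_pos h]
  · rw [if_pos ⟨hp.coprime_iff_not_dvd.2 h, hp.prime.squarefree⟩, if_neg h]
    push_cast
    rfl

lemma gcdWeight_prime_pow (n : ℕ) {p : ℕ} (hp : p.Prime) (i : ℕ) :
    gcdWeight n (p ^ (i + 2)) = 0 := by
  rw [gcdWeight_apply, if_neg]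
  rintro ⟨-, h⟩
  have := (Nat.squarefree_pow_iff hp.one_lt.ne' (by omega)).1 h
  omega

/-- The Dirichlet convolution quotient of `gcdWeight n` by `k ↦ 1/k`. -/
noncomputable def gcdQuot (n : ℕ) : ArithmeticFunction ℝ :=
  gcdWeight n * ArithmeticFunction.mobInvId

lemma isMultiplicative_gcdQuot (n : ℕ) : (gcdQuot n).IsMultiplicative :=
  (isMultiplicative_gcdWeight n).mul ArithmeticFunction.isMultiplicative_mobInvId

lemma gcdQuot_prime_pow_succ (n : ℕ) {p : ℕ} (hp : p.Prime) (i : ℕ) :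
    gcdQuot n (p ^ (i + 1)) = gcdWeight n (p ^ (i + 1)) - gcdWeight n (p ^ i) / p := by
  rw [gcdQuot, ArithmeticFunction.mul_apply_prime_pow _ _ hp, Finset.sum_range_succ,
    Finset.sum_range_succ, Finset.sum_eq_zero]
  · simp [ArithmeticFunction.moebius_apply_prime hp]
    ring
  · intro j hj
    rw [Finset.mem_range] at hj
    rw [ArithmeticFunction.mobInvId_apply, ArithmeticFunction.moebius_apply_prime_pow hp
      (by omega : i + 1 - j ≠ 0), if_neg (by omega), Int.cast_zero, zero_div, mul_zero]

lemma gcdQuot_prime (n : ℕ) {p : ℕ} (hp : p.Prime) :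
    gcdQuot n p = (if p ∣ n then 0 else (p : ℝ) / ((p : ℝ) + 1) ^ 2) - 1 / p := by
  have h := gcdQuot_prime_pow_succ n hp 0
  rwa [zero_add, pow_one, pow_zero, (isMultiplicative_gcdWeight n).map_one,
    gcdWeight_prime n hp] at h

lemma gcdQuot_prime_sq (n : ℕ) {p : ℕ} (hp : p.Prime) :
    gcdQuot n (p ^ 2) = -((if p ∣ n then 0 else (p : ℝ) / ((p : ℝ) + 1) ^ 2) / p) := by
  have h := gcdQuot_prime_pow_succ n hp 1
  rw [gcdWeight_prime_pow n hp 0, pow_one, gcdWeight_prime n hp, zero_sub] at h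
  exact h

/-- The local factor at `p` of the Dirichlet series of `gcdQuot n` at `0`. -/
noncomputable def locFactor (n p : ℕ) : ℝ :=
  if p ∣ n then 1 - 1 / (p : ℝ) else 1 - (3 * (p : ℝ) + 1) / ((p : ℝ) * ((p : ℝ) + 1) ^ 2)

lemma hasSum_gcdQuot_prime_pow (n : ℕ) {p : ℕ} (hp : p.Prime) :
    HasSum (fun i : ℕ => gcdQuot n (p ^ i)) (locFactor n p) := by
  have hp0 : (p : ℝ) ≠ 0 := by exact_mod_cast hp.ne_zero
  have hp1 : (p : ℝ) + 1 ≠ 0 := by positivity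
  have h := hasSum_sum_of_ne_finset_zero (L := .unconditional ℕ)
    (f := fun i : ℕ => gcdQuot n (p ^ i))
    (s := Finset.range 3) (fun i hi => by
      rw [Finset.mem_range] at hi
      obtain ⟨i, rfl⟩ : ∃ j, i = j + 2 + 1 := ⟨i - 3, by omega⟩
      simp only [gcdQuot_prime_pow_succ n hp, gcdWeight_prime_pow n hp,
        show i + 2 + 1 = (i + 1) + 2 by ring, zero_div, sub_zero])
  convert h using 1
  simp only [Finset.sum_range_succ, Finset.sum_range_zero, gcdQuot_prime n hp,
    gcdQuot_prime_sq n hp, pow_zero, (isMultiplicative_gcdQuot n).map_one, zero_add, pow_one,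
    locFactor]
  split_ifs
  · ring
  · field_simp
    ring

lemma hasSum_abs_gcdQuot_prime_pow (n : ℕ) {p : ℕ} (hp : p.Prime) :
    ∃ s ≤ 1 + (3 * (p : ℝ) ^ (-2 : ℝ) + if p ∣ n then (1 : ℝ) else 0),
      HasSum (fun i : ℕ => |gcdQuot n (p ^ i)|) s := by
  have hp0 : (0 : ℝ) < p := by exact_mod_cast hp.pos
  have hp1 : (1 : ℝ) ≤ p := by exact_mod_cast hp.one_le
  have h := hasSum_sum_of_ne_finset_zero (L := .unconditional ℕ)
    (f := fun i : ℕ => |gcdQuot n (p ^ i)|)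
    (s := Finset.range 3) (fun i hi => by
      rw [Finset.mem_range] at hi
      obtain ⟨i, rfl⟩ : ∃ j, i = j + 2 + 1 := ⟨i - 3, by omega⟩
      simp only [gcdQuot_prime_pow_succ n hp, gcdWeight_prime_pow n hp,
        show i + 2 + 1 = (i + 1) + 2 by ring, zero_div, sub_zero, abs_zero])
  refine ⟨_, ?_, h⟩
  simp only [Finset.sum_range_succ, Finset.sum_range_zero, gcdQuot_prime n hp,
    gcdQuot_prime_sq n hp, pow_zero, (isMultiplicative_gcdQuot n).map_one, zero_add, pow_one]
  rw [abs_one, Real.rpow_neg hp0.le, Real.rpow_two]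
  split_ifs
  · have h3 : 1 / (p : ℝ) ≤ 1 := (div_le_one hp0).2 hp1
    have h4 : 0 < ((p : ℝ) ^ 2)⁻¹ := by positivity
    rw [zero_sub, abs_neg, abs_of_pos (by positivity)]
    simp
    simp at h3
    linarith
  · have h3 : (p : ℝ) / ((p : ℝ) + 1) ^ 2 - 1 / p =
        -((2 * p + 1) / (p * ((p : ℝ) + 1) ^ 2)) := by
      field_simp
      ring
    have h4 : (p : ℝ) / ((p : ℝ) + 1) ^ 2 / p = 1 / ((p : ℝ) + 1) ^ 2 := by
      field_simp
    rw [h3, h4, abs_neg, abs_neg, abs_of_pos (by positivity), abs_of_pos (by positivity)]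
    have h5 : (2 * (p : ℝ) + 1) / (p * ((p : ℝ) + 1) ^ 2) ≤ 2 * ((p : ℝ) ^ 2)⁻¹ := by
      rw [← div_eq_mul_inv, div_le_div_iff₀ (by positivity) (by positivity)]
      nlinarith [mul_pos hp0 hp0, mul_pos (mul_pos hp0 hp0) hp0]
    have h6 : 1 / ((p : ℝ) + 1) ^ 2 ≤ ((p : ℝ) ^ 2)⁻¹ := by
      rw [← one_div]
      gcongr
      linarith
    linarith

lemma summable_gcdQuot {n : ℕ} (hn : n ≠ 0) : Summable fun k => ‖gcdQuot n k‖ := by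
  have hc : Summable fun p : ℕ => 3 * (p : ℝ) ^ (-2 : ℝ) + if p ∣ n then (1 : ℝ) else 0 := by
    refine ((Real.summable_nat_rpow.2 (by norm_num)).mul_left 3).add
      (summable_of_hasFiniteSupport ((Set.finite_Iic n).subset fun p hp => ?_))
    rw [Function.mem_support] at hp
    exact Nat.le_of_dvd (Nat.pos_of_ne_zero hn) (by_contra fun h => hp (if_neg h))
  refine summable_of_sum_range_le (fun _ => norm_nonneg _) (c := Real.exp (∑' p : ℕ,
    (3 * (p : ℝ) ^ (-2 : ℝ) + if p ∣ n then (1 : ℝ) else 0))) fun N => ?_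
  have hm := isMultiplicative_gcdQuot n
  have h := sum_Ioc_le_prod_primesBelow (f := fun k => ‖gcdQuot n k‖)
    (c := fun p => 3 * (p : ℝ) ^ (-2 : ℝ) + if p ∣ n then (1 : ℝ) else 0)
    (by simp [hm.map_one]) (fun _ => norm_nonneg _)
    (fun {a b} hab => by rw [hm.map_mul_of_coprime hab, norm_mul])
    (fun hp => (hasSum_abs_gcdQuot_prime_pow n hp).choose_spec.2.summable)
    (fun hp => by
      obtain ⟨s, hs, h⟩ := hasSum_abs_gcdQuot_prime_pow n hp
      exact h.tsum_eq.trans_le hs) N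
  refine le_trans ?_ (h.trans (prod_one_add_le_exp_tsum (fun p => ?_) hc _))
  · rcases N with - | N
    · simp
    · rw [Finset.range_eq_Ico, Finset.sum_eq_sum_Ico_succ_bot (Nat.succ_pos N)]
      simp only [ArithmeticFunction.map_zero, norm_zero, zero_add]
      refine Finset.sum_le_sum_of_subset_of_nonneg (fun k hk => ?_) fun _ _ _ => norm_nonneg _
      rw [Finset.mem_Ico] at hk
      rw [Finset.mem_Ioc]
      omega
  · have : (0 : ℝ) ≤ if p ∣ n then 1 else 0 := by split_ifs <;> norm_num
    positivity

lemma hasProd_locFactor {n : ℕ} (hn : n ≠ 0) :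
    HasProd (fun p : Nat.Primes => locFactor n p) (∑' k, gcdQuot n k) := by
  have h := (isMultiplicative_gcdQuot n).eulerProduct_hasProd (summable_gcdQuot hn)
  refine h.congr_fun fun p => ?_
  exact ((hasSum_gcdQuot_prime_pow n p.2).tsum_eq).symm

lemma tsum_gcdQuot {n : ℕ} (hn : n ≠ 0) : ∑' k, gcdQuot n k = Bconst * alpha n := by
  have hB : HasProd (fun p : Nat.Primes => 1 - (3 * ((p : ℕ) : ℝ) + 1) /
      (((p : ℕ) : ℝ) * (((p : ℕ) : ℝ) + 1) ^ 2)) Bconst := by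
    refine Multipliable.hasProd ⟨_, (hasProd_locFactor one_ne_zero).congr_fun fun p => ?_⟩
    rw [locFactor, if_neg p.2.not_dvd_one]
  have hα : HasProd (fun p : Nat.Primes => if (p : ℕ) ∣ n then
      1 - ((p : ℕ) : ℝ) / (((p : ℕ) : ℝ) ^ 2 + 3 * ((p : ℕ) : ℝ) + 1) else 1) (alpha n) := by
    have h := hasProd_prod_of_ne_finset_one (L := .unconditional Nat.Primes)
      (f := fun p : Nat.Primes => if (p : ℕ) ∣ n then
        1 - ((p : ℕ) : ℝ) / (((p : ℕ) : ℝ) ^ 2 + 3 * ((p : ℕ) : ℝ) + 1) else 1)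
      (s := n.primeFactors.subtype Nat.Prime) (fun p hp => by
        exact if_neg fun hd => hp (Finset.mem_subtype.2 (Nat.mem_primeFactors.2 ⟨p.2, hd, hn⟩)))
    convert h using 1
    rw [alpha, ← Finset.prod_subtype_of_mem (p := Nat.Prime)
      (fun p : ℕ => 1 - (p : ℝ) / ((p : ℝ) ^ 2 + 3 * (p : ℝ) + 1))
      fun p hp => Nat.prime_of_mem_primeFactors hp]
    refine Finset.prod_congr rfl fun p hp => ?_
    rw [Finset.mem_subtype] at hp
    rw [if_pos (Nat.dvd_of_mem_primeFactors hp)]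
  refine (hasProd_locFactor hn).unique ((hB.mul hα).congr_fun fun p => ?_)
  have hp0 : ((p : ℕ) : ℝ) ≠ 0 := by exact_mod_cast p.2.ne_zero
  rw [locFactor]
  split_ifs
  · have h1 : ((p : ℕ) : ℝ) + 1 ≠ 0 := by positivity
    have h2 : ((p : ℕ) : ℝ) ^ 2 + 3 * ((p : ℕ) : ℝ) + 1 ≠ 0 := by positivity
    field_simp
    ring
  · rw [mul_one]

lemma tendsto_sum_invId_natDiv_sub_log {b : ℕ} (hb : 0 < b) :
    Tendsto (fun Y : ℕ => ∑ j ∈ Ioc 0 (Y / b), ArithmeticFunction.invId j - Real.log Y) atTop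
      (nhds (Real.eulerMascheroniConstant - Real.log b)) := by
  have hb0 : (0 : ℝ) < b := by exact_mod_cast hb
  have hdiv : Tendsto (fun Y : ℕ => Y / b) atTop atTop := Nat.tendsto_div_const_atTop hb.ne'
  have h1 := Real.tendsto_harmonic_sub_log.comp hdiv
  have h2 : Tendsto (fun Y : ℕ => (⌊(Y : ℝ) / b⌋₊ : ℝ) / ((Y : ℝ) / b)) atTop (nhds 1) :=
    tendsto_nat_floor_div_atTop.comp (tendsto_natCast_atTop_atTop.atTop_div_const hb0)
  have h3 := (Real.continuousAt_log one_ne_zero).tendsto.comp h2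
  rw [Real.log_one] at h3
  have h4 := (h1.add h3).sub_const (Real.log b)
  rw [add_zero] at h4
  refine h4.congr' ?_
  filter_upwards [eventually_ge_atTop b] with Y hY
  have hq : 0 < Y / b := Nat.div_pos hY hb
  have hY0 : (0 : ℝ) < Y := by exact_mod_cast hb.trans_le hY
  have hq0 : (0 : ℝ) < ((Y / b : ℕ) : ℝ) := by exact_mod_cast hq
  simp only [Function.comp_apply, Nat.floor_div_eq_div]
  rw [Real.log_div hq0.ne' (by positivity), Real.log_div hY0.ne' hb0.ne', harmonic_eq_sum_Icc]
  push_cast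
  have : ∑ j ∈ Ioc 0 (Y / b), ArithmeticFunction.invId j = ∑ j ∈ Icc 1 (Y / b), ((j : ℝ))⁻¹ :=
    Finset.sum_congr rfl fun j _ => by simp
  rw [this]
  ring

lemma sum_Ioc_invId_le {N M Y U : ℕ} (e : ℕ) (hN : N * e ≤ Y) (hM : Y < (M + 1) * (U * e)) :
    ∑ j ∈ Ioc M N, ArithmeticFunction.invId j ≤ U := by
  rcases Nat.eq_zero_or_pos Y with rfl | hY
  · have he : 0 < e := Nat.pos_of_ne_zero fun h => by simp [h] at hM
    have : N = 0 := by
      rcases Nat.mul_eq_zero.1 (Nat.le_zero.1 hN) with h | h <;> omega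
    simp [this]
  · have hY0 : (0 : ℝ) < Y := by exact_mod_cast hY
    calc _ ≤ ∑ j ∈ Ioc M N, (U * e : ℝ) / Y := by
          refine Finset.sum_le_sum fun j hj => ?_
          rw [Finset.mem_Ioc] at hj
          have hj0 : (0 : ℝ) < j := by exact_mod_cast (Nat.zero_le M).trans_lt hj.1
          rw [ArithmeticFunction.invId_apply, div_le_div_iff₀ hj0 hY0, one_mul]
          have : Y ≤ U * e * j :=
            hM.le.trans (by rw [mul_comm]; exact Nat.mul_le_mul_left _ hj.1)
          exact_mod_cast this
      _ = ((N - M : ℕ) : ℝ) * (U * e / Y) := by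
          rw [Finset.sum_const, Nat.card_Ioc, nsmul_eq_mul]
      _ ≤ N * (U * e / Y) := by
          gcongr
          exact Nat.sub_le _ _
      _ = U * ((N * e : ℕ) : ℝ) / Y := by push_cast; ring
      _ ≤ U * Y / Y := by gcongr
      _ = U := by field_simp

lemma tendsto_sum_gcdWeight {n a U : ℕ} (hn : n ≠ 0) (ha : 0 < a) (haU : a ≤ U) :
    Tendsto (fun Y : ℕ => ∑ k ∈ Ioc (Y / U) (Y / a), gcdWeight n k) atTop
      (nhds (Bconst * alpha n * Real.log ((U : ℝ) / a))) := by
  have hU : 0 < U := ha.trans_le haU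
  set H : ℕ → ℝ := fun N => ∑ j ∈ Ioc 0 N, ArithmeticFunction.invId j with hH
  have hconv : ∀ N, ∑ k ∈ Ioc 0 N, gcdWeight n k = ∑' e, gcdQuot n e * H (N / e) := by
    intro N
    rw [← ArithmeticFunction.mul_mobInvId_mul_invId (gcdWeight n),
      ArithmeticFunction.sum_Ioc_mul_eq_sum_sum, tsum_eq_sum (s := Ioc 0 N)]
    · rfl
    · intro e he
      rcases Nat.eq_zero_or_pos e with rfl | he0
      · simp
      · rw [Finset.mem_Ioc, not_and, not_le] at he
        simp [hH, Nat.div_eq_of_lt (he he0)]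
  have hsum : ∀ N, Summable fun e => gcdQuot n e * H (N / e) := by
    intro N
    refine summable_of_hasFiniteSupport ((Set.finite_Iic N).subset fun e he => ?_)
    by_contra h
    rw [Set.mem_Iic, not_le] at h
    exact he (by simp [hH, Nat.div_eq_of_lt h])
  have hdiff : ∀ M N, M ≤ N → H N - H M = ∑ j ∈ Ioc M N, ArithmeticFunction.invId j := by
    intro M N h
    simp only [hH]
    rw [sub_eq_iff_eq_add', ← Finset.sum_Ioc_consecutive _ (Nat.zero_le M) h]
  have heq : ∀ Y, ∑ k ∈ Ioc (Y / U) (Y / a), gcdWeight n k =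
      ∑' e, gcdQuot n e * (H (Y / a / e) - H (Y / U / e)) := by
    intro Y
    have h1 := Finset.sum_Ioc_consecutive (gcdWeight n) (Nat.zero_le (Y / U))
      (Nat.div_le_div_left haU ha : Y / U ≤ Y / a)
    rw [hconv, hconv] at h1
    rw [← eq_sub_iff_add_eq'] at h1
    rw [h1, ← (hsum _).tsum_sub (hsum _)]
    exact tsum_congr fun e => (mul_sub _ _ _).symm
  simp only [heq]
  have hlim := tendsto_tsum_of_dominated_convergence
    (f := fun (Y : ℕ) (e : ℕ) => gcdQuot n e * (H (Y / a / e) - H (Y / U / e)))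
    (g := fun e => gcdQuot n e * Real.log ((U : ℝ) / a)) (𝓕 := atTop)
    (bound := fun e => ‖gcdQuot n e‖ * U) ((summable_gcdQuot hn).mul_right _) ?_ ?_
  · rwa [tsum_mul_right, tsum_gcdQuot hn] at hlim
  · intro e
    rcases Nat.eq_zero_or_pos e with rfl | he
    · simp
    · refine Tendsto.const_mul _ ?_
      have h1 := (tendsto_sum_invId_natDiv_sub_log (Nat.mul_pos ha he)).sub
        (tendsto_sum_invId_natDiv_sub_log (Nat.mul_pos hU he))
      have ha0 : (a : ℝ) ≠ 0 := by exact_mod_cast ha.ne'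
      have hU0 : (U : ℝ) ≠ 0 := by exact_mod_cast hU.ne'
      have he0 : (e : ℝ) ≠ 0 := by exact_mod_cast he.ne'
      refine (h1.congr fun Y => ?_).trans (le_of_eq ?_)
      · simp only [hH, Nat.div_div_eq_div_mul]
        ring
      · congr 1
        push_cast
        rw [Real.log_mul ha0 he0, Real.log_mul hU0 he0, Real.log_div hU0 ha0]
        ring
  · refine Eventually.of_forall fun Y e => ?_
    rw [norm_mul]
    refine mul_le_mul_of_nonneg_left ?_ (norm_nonneg _)
    rcases Nat.eq_zero_or_pos e with rfl | he
    · simp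
    have hle : Y / U / e ≤ Y / a / e := Nat.div_le_div_right (Nat.div_le_div_left haU ha)
    rw [hdiff _ _ hle, Real.norm_of_nonneg (Finset.sum_nonneg fun j _ => by simp)]
    refine sum_Ioc_invId_le (Y := Y) e ?_ ?_
    · exact (Nat.div_mul_le_self _ _).trans (Nat.div_le_self _ _)
    · rw [Nat.div_div_eq_div_mul, mul_comm]
      exact Nat.lt_mul_div_succ _ (Nat.mul_pos hU he)

lemma primeFactors_lcm {a b : ℕ} (ha : a ≠ 0) (hb : b ≠ 0) :
    (Nat.lcm a b).primeFactors = a.primeFactors ∪ b.primeFactors := by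
  ext p
  simp only [Finset.mem_union, Nat.mem_primeFactors]
  constructor
  · rintro ⟨hp, hd, -⟩
    rcases hp.dvd_mul.1 (hd.trans (Nat.lcm_dvd_mul a b)) with h | h
    · exact Or.inl ⟨hp, h, ha⟩
    · exact Or.inr ⟨hp, h, hb⟩
  · rintro (⟨hp, h, -⟩ | ⟨hp, h, -⟩)
    · exact ⟨hp, h.trans (Nat.dvd_lcm_left a b), Nat.lcm_ne_zero ha hb⟩
    · exact ⟨hp, h.trans (Nat.dvd_lcm_right a b), Nat.lcm_ne_zero ha hb⟩

lemma psi_lcm_eq_mul {a m : ℕ} (ha : a ≠ 0) (hm : m ≠ 0) :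
    psi (Nat.lcm a m) = psi m * psiM m a := by
  rw [psi, psi, psiM, primeFactors_lcm ha hm, ← Finset.prod_union]
  · refine Finset.prod_congr ?_ fun _ _ => rfl
    ext p
    simp only [Finset.mem_union, Finset.mem_filter, Nat.mem_primeFactors]
    tauto
  · rw [Finset.disjoint_left]
    intro p h1 h2
    exact (Finset.mem_filter.1 h2).2 (Nat.dvd_of_mem_primeFactors h1)

lemma psiM_lcm_mul_psiM_gcd (m : ℕ) {d t : ℕ} (hd : d ≠ 0) (ht : t ≠ 0) :
    psiM m (Nat.lcm d t) * psiM m (Nat.gcd d t) = psiM m d * psiM m t := by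
  rw [psiM, psiM, psiM, psiM, primeFactors_lcm hd ht, Nat.primeFactors_gcd hd ht,
    Finset.filter_union, Finset.filter_inter_distrib, Finset.prod_union_inter]

open Classical in
lemma psiM_eq_sum_divisors (m : ℕ) {g : ℕ} (hg : Squarefree g) :
    (psiM m g : ℝ) = ∑ k ∈ g.divisors, if k.Coprime m then (k : ℝ) else 0 := by
  let f : ArithmeticFunction ℝ := ⟨fun k => if k.Coprime m then (k : ℝ) else 0, by simp⟩
  have hf : f.IsMultiplicative := by
    refine ⟨by simp [f], fun {a b} _ => ?_⟩
    simp only [f, ArithmeticFunction.coe_mk, Nat.coprime_mul_iff_left]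
    by_cases h1 : a.Coprime m
    · by_cases h2 : b.Coprime m
      · rw [if_pos ⟨h1, h2⟩, if_pos h1, if_pos h2, Nat.cast_mul]
      · rw [if_neg (fun h => h2 h.2), if_neg h2, mul_zero]
    · rw [if_neg (fun h => h1 h.1), if_neg h1, zero_mul]
  refine Eq.trans ?_ (hf.prodPrimeFactors_one_add_of_squarefree hg)
  rw [psiM, Nat.cast_prod, Finset.prod_filter]
  refine Finset.prod_congr rfl fun p hp => ?_
  simp only [f, ArithmeticFunction.coe_mk,
    (Nat.prime_of_mem_primeFactors hp).coprime_iff_not_dvd]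
  split_ifs <;> push_cast <;> ring

lemma psiM_eq_psi {m k : ℕ} (h : k.Coprime m) : psiM m k = psi k := by
  rw [psiM, psi, Finset.filter_true_of_mem]
  intro p hp hpm
  have hk := Nat.mem_primeFactors.1 hp
  exact hk.1.not_dvd_one (h ▸ Nat.dvd_gcd hk.2.1 hpm)

lemma sum_Ioc_filter_dvd (F : ℕ → ℝ) {k : ℕ} (hk : 0 < k) (N : ℕ) :
    ∑ d ∈ (Ioc 0 N).filter (k ∣ ·), F d = ∑ e ∈ Ioc 0 (N / k), F (k * e) := by
  refine (Finset.sum_bij (fun e _ => k * e) (fun e he => ?_) (fun a _ b _ h => ?_)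
    (fun d hd => ?_) fun e _ => rfl).symm
  · rw [Finset.mem_Ioc, Nat.le_div_iff_mul_le hk] at he
    rw [Finset.mem_filter, Finset.mem_Ioc]
    exact ⟨⟨Nat.mul_pos hk he.1, by rw [mul_comm]; exact he.2⟩, Dvd.intro _ rfl⟩
  · exact Nat.eq_of_mul_eq_mul_left hk h
  · rw [Finset.mem_filter, Finset.mem_Ioc] at hd
    obtain ⟨⟨h1, h2⟩, e, rfl⟩ := hd
    refine ⟨e, ?_, rfl⟩
    rw [Finset.mem_Ioc, Nat.le_div_iff_mul_le hk, mul_comm]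
    exact ⟨Nat.pos_of_mul_pos_left h1, h2⟩

/-- The quotient `μ(d)/ψ_m(d)`. -/
noncomputable def mobDivPsi (m d : ℕ) : ℝ := (ArithmeticFunction.moebius d : ℝ) / psiM m d

lemma mobDivPsi_mul {m k : ℕ} (hkm : k.Coprime m) (e : ℕ) :
    mobDivPsi m (k * e) = (ArithmeticFunction.moebius k : ℝ) / psi k * mobPsi m k e := by
  rw [mobDivPsi, mobPsi_apply]
  by_cases h : e.Coprime k
  · rw [if_pos h, psiM_mul h.symm, psiM_eq_psi hkm,
      ArithmeticFunction.isMultiplicative_moebius.map_mul_of_coprime h.symm]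
    push_cast
    rw [mul_div_mul_comm]
  · rw [if_neg h, ArithmeticFunction.moebius_eq_zero_of_not_squarefree, Int.cast_zero, zero_div,
      mul_zero]
    exact fun hs => h (Nat.coprime_of_squarefree_mul hs).symm

/-- The quadratic form `∑_{d, t ≤ Y} μ(d) μ(t) / ψ_m([d, t])` after diagonalization. -/
noncomputable def diagSum (m Y : ℕ) : ℝ :=
  ∑ k ∈ Ioc 0 Y, gcdWeight m k * (∑ n ∈ Ioc 0 (Y / k), mobPsi m k n) ^ 2

open Classical in
lemma moebius_mul_div_psi_lcm {m d t : ℕ} (hm : m ≠ 0) (hd : d ≠ 0) (ht : t ≠ 0) :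
    ((ArithmeticFunction.moebius d : ℝ) * (ArithmeticFunction.moebius t : ℝ)) /
        (psi (Nat.lcm (Nat.lcm d t) m) : ℝ) =
      1 / (psi m : ℝ) * (mobDivPsi m d * mobDivPsi m t *
        ∑ k ∈ (Nat.gcd d t).divisors, if k.Coprime m then (k : ℝ) else 0) := by
  by_cases hds : Squarefree d
  · rw [← psiM_eq_sum_divisors m (hds.squarefree_of_dvd (Nat.gcd_dvd_left d t)),
      psi_lcm_eq_mul (Nat.lcm_ne_zero hd ht) hm, mobDivPsi, mobDivPsi]
    have h := congrArg (Nat.cast : ℕ → ℝ) (psiM_lcm_mul_psiM_gcd m hd ht)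
    push_cast at h ⊢
    have p1 : (psiM m d : ℝ) ≠ 0 := by exact_mod_cast (psiM_pos m d).ne'
    have p2 : (psiM m t : ℝ) ≠ 0 := by exact_mod_cast (psiM_pos m t).ne'
    have p3 : (psiM m (Nat.lcm d t) : ℝ) ≠ 0 := by exact_mod_cast (psiM_pos m _).ne'
    have p4 : (psi m : ℝ) ≠ 0 := by exact_mod_cast (psi_pos m).ne'
    field_simp
    linear_combination -(ArithmeticFunction.moebius t : ℝ) * h
  · simp [mobDivPsi, ArithmeticFunction.moebius_eq_zero_of_not_squarefree hds]

lemma T_eq_diagSum (y : ℝ) {m : ℕ} (hm : m ≠ 0) :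
    T y m = 6 / (Real.pi ^ 2 * (psi m : ℝ)) * diagSum m ⌊y⌋₊ := by
  classical
  set Y := ⌊y⌋₊
  have hsum : ∑ d ∈ Ioc 0 Y, ∑ t ∈ Ioc 0 Y, mobDivPsi m d * mobDivPsi m t *
        (∑ k ∈ (Nat.gcd d t).divisors, if k.Coprime m then (k : ℝ) else 0) = diagSum m Y := by
    calc
      _ = ∑ d ∈ Ioc 0 Y, ∑ t ∈ Ioc 0 Y, ∑ k ∈ Ioc 0 Y, (if k.Coprime m then (k : ℝ) else 0) *
            ((if k ∣ d then mobDivPsi m d else 0) * (if k ∣ t then mobDivPsi m t else 0)) := by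
        refine Finset.sum_congr rfl fun d hd => Finset.sum_congr rfl fun t ht => ?_
        rw [Finset.mem_Ioc] at hd ht
        have hdiv : (Nat.gcd d t).divisors = (Ioc 0 Y).filter fun k => k ∣ d ∧ k ∣ t := by
          ext k
          simp only [Nat.mem_divisors, Finset.mem_filter, Finset.mem_Ioc, Nat.dvd_gcd_iff]
          refine ⟨fun h => ⟨⟨Nat.pos_of_dvd_of_pos h.1.1 hd.1,
            (Nat.le_of_dvd hd.1 h.1.1).trans hd.2⟩, h.1⟩, fun h => ⟨h.2, ?_⟩⟩
          exact (Nat.gcd_pos_of_pos_left _ hd.1).ne'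
        rw [hdiv, Finset.mul_sum, Finset.sum_filter]
        refine Finset.sum_congr rfl fun k _ => ?_
        by_cases h1 : k ∣ d <;> by_cases h2 : k ∣ t <;> simp [h1, h2, mul_comm]
      _ = ∑ k ∈ Ioc 0 Y, (if k.Coprime m then (k : ℝ) else 0) *
            (∑ d ∈ Ioc 0 Y, if k ∣ d then mobDivPsi m d else 0) ^ 2 := by
        rw [Finset.sum_congr rfl fun d _ => Finset.sum_comm, Finset.sum_comm]
        refine Finset.sum_congr rfl fun k _ => ?_
        rw [sq, Finset.sum_mul_sum, Finset.mul_sum]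
        exact Finset.sum_congr rfl fun d _ => (Finset.mul_sum _ _ _).symm
      _ = diagSum m Y := by
        refine Finset.sum_congr rfl fun k hk => ?_
        rw [Finset.mem_Ioc] at hk
        rw [gcdWeight_apply]
        by_cases hkm : k.Coprime m
        · rw [← Finset.sum_filter, sum_Ioc_filter_dvd _ hk.1, if_pos hkm,
            Finset.sum_congr rfl fun e _ => mobDivPsi_mul hkm e, ← Finset.mul_sum, mul_pow,
            div_pow]
          by_cases hs : Squarefree k
          · rw [if_pos ⟨hkm, hs⟩]
            have : (ArithmeticFunction.moebius k : ℝ) ^ 2 = 1 := by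
              exact_mod_cast ArithmeticFunction.moebius_sq_eq_one_of_squarefree hs
            rw [this]
            ring
          · rw [if_neg fun h => hs h.2, ArithmeticFunction.moebius_eq_zero_of_not_squarefree hs]
            simp
        · rw [if_neg hkm, if_neg fun h => hkm h.1, zero_mul, zero_mul]
  rw [T, ← hsum]
  have : ∑ d ∈ Icc 1 Y, ∑ t ∈ Icc 1 Y,
      ((ArithmeticFunction.moebius d : ℝ) * (ArithmeticFunction.moebius t : ℝ)) /
        (psi (Nat.lcm (Nat.lcm d t) m) : ℝ) =
      ∑ d ∈ Ioc 0 Y, ∑ t ∈ Ioc 0 Y, 1 / (psi m : ℝ) * (mobDivPsi m d * mobDivPsi m t *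
        (∑ k ∈ (Nat.gcd d t).divisors, if k.Coprime m then (k : ℝ) else 0)) := by
    refine Finset.sum_congr rfl fun d hd => Finset.sum_congr rfl fun t ht => ?_
    rw [Finset.mem_Ioc] at hd ht
    exact moebius_mul_div_psi_lcm hm hd.1.ne' ht.1.ne'
  rw [this]
  simp only [← Finset.mul_sum]
  rw [← mul_assoc, mul_one_div, div_div]

lemma gcdWeight_le_inv (n k : ℕ) : gcdWeight n k ≤ 1 / k := by
  rcases Nat.eq_zero_or_pos k with rfl | hk
  · simp
  have hk0 : (0 : ℝ) < k := by exact_mod_cast hk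
  rw [gcdWeight_apply]
  split_ifs with h
  · have h1 : k ≤ psi k := by
      calc k = ∏ p ∈ k.primeFactors, p := (Nat.prod_primeFactors_of_squarefree h.2).symm
        _ ≤ psi k := Finset.prod_le_prod' fun p _ => Nat.le_succ p
    have h2 : (k : ℝ) ≤ psi k := by exact_mod_cast h1
    have h3 : (0 : ℝ) < psi k := hk0.trans_le h2
    rw [div_le_div_iff₀ (by positivity) hk0]
    nlinarith
  · positivity

lemma gcdWeight_of_not_squarefree (n : ℕ) {k : ℕ} (hk : ¬ Squarefree k) : gcdWeight n k = 0 := by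
  rw [gcdWeight_apply, if_neg fun h => hk h.2]

lemma exists_tail_le : ∃ C > 0, ∃ ε : ℕ → ℝ, Tendsto ε atTop (nhds 0) ∧
    ∀ m U Y : ℕ, m ≠ 0 → 1 ≤ U →
      ∑ k ∈ Ioc 0 (Y / U), gcdWeight m k * (∑ n ∈ Ioc 0 (Y / k), mobPsi m k n) ^ 2 ≤
        C * Real.sqrt (psi m) * ε U := by
  obtain ⟨C₁, hC₁, H₁⟩ := sq_sum_mobPsi_le
  obtain ⟨C₂, hC₂, H₂⟩ := exists_prod_le_sqrt_psi
  obtain ⟨ε, hε, H₃⟩ := exists_sum_gProd_le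
  refine ⟨C₁ * C₂, by positivity, ε, hε, fun m U Y hm hU => ?_⟩
  calc
    _ = ∑ k ∈ (Ioc 0 (Y / U)).filter Squarefree,
          gcdWeight m k * (∑ n ∈ Ioc 0 (Y / k), mobPsi m k n) ^ 2 := by
      refine (Finset.sum_filter_of_ne fun k _ h => ?_).symm
      by_contra hs
      exact h (by rw [gcdWeight_of_not_squarefree m hs, zero_mul])
    _ ≤ ∑ k ∈ (Ioc 0 (Y / U)).filter Squarefree, C₁ * (C₂ * Real.sqrt (psi m)) *
          (gProd k / k * (1 + Real.log ((Y / k : ℕ) : ℝ)) ^ (-(4 / 3) : ℝ)) := by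
      refine Finset.sum_le_sum fun k hk => ?_
      rw [Finset.mem_filter, Finset.mem_Ioc] at hk
      have hkY : 1 ≤ Y / k := Nat.div_pos (hk.1.2.trans (Nat.div_le_self _ _)) hk.1.1
      have hlog : 0 ≤ Real.log ((Y / k : ℕ) : ℝ) := Real.log_nonneg (by exact_mod_cast hkY)
      have hg : 0 ≤ gProd k := Finset.prod_nonneg fun p _ => by positivity
      calc
        _ ≤ 1 / (k : ℝ) * (C₁ * (C₂ * Real.sqrt (psi m)) * gProd k *
              (1 + Real.log ((Y / k : ℕ) : ℝ)) ^ (-(4 / 3) : ℝ)) := by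
          refine mul_le_mul (gcdWeight_le_inv m k)
            ((H₁ m k (Y / k) hm hk.1.1.ne' hkY).trans ?_) (sq_nonneg _) (by positivity)
          refine mul_le_mul_of_nonneg_right ?_ (by positivity)
          exact mul_le_mul_of_nonneg_right (mul_le_mul_of_nonneg_left (H₂ m) hC₁.le) hg
        _ = _ := by ring
    _ ≤ _ := by
      rw [← Finset.mul_sum, ← mul_assoc]
      exact mul_le_mul_of_nonneg_left (H₃ U Y hU) (by positivity)

open Classical in
lemma gcdWeight_mul_ite (m d t k : ℕ) :
    gcdWeight m k * ((if k.Coprime d then 1 else 0) * (if k.Coprime t then 1 else 0)) =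
      gcdWeight (d * t * m) k := by
  rw [gcdWeight_apply, gcdWeight_apply]
  simp only [Nat.coprime_mul_iff_right]
  split_ifs <;> first | tauto | simp

lemma sum_mobPsi_eq {m k U Y : ℕ} (hU : 0 < U) (hk : Y / U < k) :
    ∑ n ∈ Ioc 0 (Y / k), mobPsi m k n =
      ∑ d ∈ Ioc 0 U, (if d ≤ Y / k then 1 else 0) * (if k.Coprime d then 1 else 0) *
        mobDivPsi m d := by
  have hk0 : 0 < k := (Nat.zero_le _).trans_lt hk
  have hlt : Y / k < U := by
    rw [Nat.div_lt_iff_lt_mul hU] at hk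
    rwa [Nat.div_lt_iff_lt_mul hk0, mul_comm]
  have hset : Ioc 0 (Y / k) = (Ioc 0 U).filter (· ≤ Y / k) := by
    ext d
    simp only [Finset.mem_Ioc, Finset.mem_filter]
    omega
  rw [hset, Finset.sum_filter]
  refine Finset.sum_congr rfl fun d _ => ?_
  rw [mobPsi_apply, mobDivPsi]
  simp only [Nat.coprime_comm (n := k)]
  split_ifs <;> simp

lemma sum_Ioc_gcdWeight_mul_sq (m Y : ℕ) {U : ℕ} (hU : 0 < U) :
    ∑ k ∈ Ioc (Y / U) Y, gcdWeight m k * (∑ n ∈ Ioc 0 (Y / k), mobPsi m k n) ^ 2 =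
      ∑ d ∈ Ioc 0 U, ∑ t ∈ Ioc 0 U, mobDivPsi m d * mobDivPsi m t *
        ∑ k ∈ Ioc (Y / U) (Y / max d t), gcdWeight (d * t * m) k := by
  calc
    _ = ∑ k ∈ Ioc (Y / U) Y, ∑ d ∈ Ioc 0 U, ∑ t ∈ Ioc 0 U, mobDivPsi m d * mobDivPsi m t *
          (if k ≤ Y / max d t then gcdWeight (d * t * m) k else 0) := by
      refine Finset.sum_congr rfl fun k hk => ?_
      rw [Finset.mem_Ioc] at hk
      have hk0 : 0 < k := (Nat.zero_le _).trans_lt hk.1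
      rw [sum_mobPsi_eq hU hk.1, sq, Finset.sum_mul_sum, Finset.mul_sum]
      refine Finset.sum_congr rfl fun d hd => ?_
      rw [Finset.mul_sum]
      refine Finset.sum_congr rfl fun t _ => ?_
      have hd0 : 0 < max d t := (Finset.mem_Ioc.1 hd).1.trans_le (le_max_left d t)
      have hiff : k ≤ Y / max d t ↔ d ≤ Y / k ∧ t ≤ Y / k := by
        rw [Nat.le_div_iff_mul_le hd0, mul_comm, ← Nat.le_div_iff_mul_le hk0, max_le_iff]
      rw [← gcdWeight_mul_ite]
      simp only [hiff]
      by_cases h1 : d ≤ Y / k <;> by_cases h2 : t ≤ Y / k <;> simp [h1, h2, mul_comm]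
    _ = _ := by
      rw [Finset.sum_comm, Finset.sum_congr rfl fun d _ => Finset.sum_comm]
      refine Finset.sum_congr rfl fun d _ => Finset.sum_congr rfl fun t _ => ?_
      rw [← Finset.mul_sum, ← Finset.sum_filter]
      congr 2
      ext k
      have := Nat.div_le_self Y (max d t)
      simp only [Finset.mem_Ioc, Finset.mem_filter]
      omega

lemma log_div_eq_sum {a V : ℕ} (ha : 0 < a) (haV : a ≤ V + 1) :
    Real.log (((V + 1 : ℕ) : ℝ) / a) =
      ∑ j ∈ Ioc 0 V, if a ≤ j then Real.log (1 + 1 / (j : ℝ)) else 0 := by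
  induction V with
  | zero =>
    obtain rfl : a = 1 := by omega
    simp
  | succ V ih =>
    rw [Finset.sum_Ioc_succ_top (Nat.zero_le V)]
    have ha0 : (0 : ℝ) < a := by exact_mod_cast ha
    rcases haV.lt_or_eq with h | h
    · rw [← ih (by omega), if_pos (by omega), ← Real.log_mul (by positivity) (by positivity)]
      congr 1
      push_cast
      field_simp
    · rw [if_neg (by omega), Finset.sum_eq_zero fun j hj => if_neg ?_, ← h,
        div_self ha0.ne', Real.log_one, add_zero]
      rw [Finset.mem_Ioc] at hj
      omega

/-- The inner double sum of the limit formula. -/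
noncomputable def alphaSum (m j : ℕ) : ℝ :=
  ∑ d ∈ Icc 1 j, ∑ t ∈ Icc 1 j,
    alpha (d * t * m) * (ArithmeticFunction.moebius d : ℝ) *
      (ArithmeticFunction.moebius t : ℝ) / ((psiM m d : ℝ) * (psiM m t : ℝ))

lemma alphaSum_eq (m : ℕ) {j V : ℕ} (hj : j ≤ V) :
    alphaSum m j = ∑ d ∈ Ioc 0 (V + 1), ∑ t ∈ Ioc 0 (V + 1),
      if max d t ≤ j then mobDivPsi m d * mobDivPsi m t * alpha (d * t * m) else 0 := by
  have hset : Icc 1 j = (Ioc 0 (V + 1)).filter (· ≤ j) := by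
    ext d
    simp only [Finset.mem_Ioc, Finset.mem_filter, Finset.mem_Icc]
    omega
  rw [alphaSum, hset, Finset.sum_filter]
  refine Finset.sum_congr rfl fun d _ => ?_
  rw [Finset.sum_filter]
  by_cases hd : d ≤ j
  · rw [if_pos hd]
    refine Finset.sum_congr rfl fun t _ => ?_
    simp only [max_le_iff, hd, true_and, mobDivPsi]
    congr 1
    rw [div_mul_div_comm]
    ring
  · rw [if_neg hd]
    simp [hd]

lemma sum_log_mul_alphaSum (m V : ℕ) :
    ∑ j ∈ Ioc 0 V, Real.log (1 + 1 / (j : ℝ)) * alphaSum m j =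
      ∑ d ∈ Ioc 0 (V + 1), ∑ t ∈ Ioc 0 (V + 1), mobDivPsi m d * mobDivPsi m t *
        (alpha (d * t * m) * Real.log (((V + 1 : ℕ) : ℝ) / (max d t : ℕ))) := by
  calc
    _ = ∑ j ∈ Ioc 0 V, ∑ d ∈ Ioc 0 (V + 1), ∑ t ∈ Ioc 0 (V + 1),
          mobDivPsi m d * mobDivPsi m t * (alpha (d * t * m) *
            if max d t ≤ j then Real.log (1 + 1 / (j : ℝ)) else 0) := by
      refine Finset.sum_congr rfl fun j hj => ?_
      rw [alphaSum_eq m (Finset.mem_Ioc.1 hj).2]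
      simp only [Finset.mul_sum]
      refine Finset.sum_congr rfl fun d _ => Finset.sum_congr rfl fun t _ => ?_
      split_ifs
      · ring
      · simp
    _ = _ := by
      rw [Finset.sum_comm, Finset.sum_congr rfl fun d _ => Finset.sum_comm]
      refine Finset.sum_congr rfl fun d hd => Finset.sum_congr rfl fun t ht => ?_
      rw [Finset.mem_Ioc] at hd ht
      rw [log_div_eq_sum (hd.1.trans_le (le_max_left d t)) (max_le hd.2 ht.2), Finset.mul_sum,
        Finset.mul_sum]

lemma tendsto_sum_Ioc_gcdWeight_mul_sq {m : ℕ} (hm : m ≠ 0) (V : ℕ) :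
    Tendsto (fun Y : ℕ => ∑ k ∈ Ioc (Y / (V + 1)) Y,
        gcdWeight m k * (∑ n ∈ Ioc 0 (Y / k), mobPsi m k n) ^ 2) atTop
      (nhds (Bconst * ∑ j ∈ Ioc 0 V, Real.log (1 + 1 / (j : ℝ)) * alphaSum m j)) := by
  simp only [sum_Ioc_gcdWeight_mul_sq m _ V.succ_pos, sum_log_mul_alphaSum,
    Finset.mul_sum (a := Bconst)]
  refine tendsto_finsetSum _ fun d hd => tendsto_finsetSum _ fun t ht => ?_
  rw [Finset.mem_Ioc] at hd ht
  have h := (tendsto_sum_gcdWeight (n := d * t * m) (a := max d t) (U := V + 1)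
    (by have := hd.1.ne'; have := ht.1.ne'; positivity)
    (hd.1.trans_le (le_max_left d t)) (max_le hd.2 ht.2)).const_mul
      (mobDivPsi m d * mobDivPsi m t)
  convert h using 2
  ring

lemma diagSum_eq_add (m Y : ℕ) (U : ℕ) :
    diagSum m Y =
      ∑ k ∈ Ioc (Y / U) Y, gcdWeight m k * (∑ n ∈ Ioc 0 (Y / k), mobPsi m k n) ^ 2 +
      ∑ k ∈ Ioc 0 (Y / U), gcdWeight m k * (∑ n ∈ Ioc 0 (Y / k), mobPsi m k n) ^ 2 := by
  rw [diagSum, add_comm, Finset.sum_Ioc_consecutive _ (Nat.zero_le _) (Nat.div_le_self Y U)]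

lemma exists_tendsto_diagSum : ∃ K > 0, ∀ m : ℕ, m ≠ 0 →
    Tendsto (diagSum m) atTop
      (nhds (Bconst * ∑' j : ℕ+, Real.log (1 + 1 / (j : ℝ)) * alphaSum m j)) ∧
    |Bconst * ∑' j : ℕ+, Real.log (1 + 1 / (j : ℝ)) * alphaSum m j| ≤
      K * Real.sqrt (psi m) := by
  obtain ⟨C, hC, ε, hε, htail⟩ := exists_tail_le
  refine ⟨C * (|ε 1| + 1), by positivity, fun m hm => ?_⟩
  set G : ℕ → ℕ → ℝ := fun Y k => gcdWeight m k * (∑ n ∈ Ioc 0 (Y / k), mobPsi m k n) ^ 2 with hG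
  have hG0 : ∀ Y k, 0 ≤ G Y k := fun Y k => mul_nonneg (gcdWeight_nonneg m k) (sq_nonneg _)
  have hpsi : 0 ≤ Real.sqrt (psi m) := Real.sqrt_nonneg _
  set P : ℕ → ℝ := fun V => Bconst * ∑ j ∈ Ioc 0 V, Real.log (1 + 1 / (j : ℝ)) * alphaSum m j
    with hP
  have hlim : ∀ V, Tendsto (fun Y : ℕ => ∑ k ∈ Ioc (Y / (V + 1)) Y, G Y k) atTop (nhds (P V)) :=
    fun V => tendsto_sum_Ioc_gcdWeight_mul_sq hm V
  have hD0 : ∀ Y, 0 ≤ diagSum m Y := fun Y => Finset.sum_nonneg fun k _ => hG0 Y k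
  have hDle : ∀ Y, diagSum m Y ≤ C * Real.sqrt (psi m) * |ε 1| := fun Y => by
    have h := htail m 1 Y hm le_rfl
    rw [Nat.div_one] at h
    exact h.trans (mul_le_mul_of_nonneg_left (le_abs_self _) (by positivity))
  have hle : ∀ V Y, ∑ k ∈ Ioc (Y / (V + 1)) Y, G Y k ≤ diagSum m Y := fun V Y => by
    rw [diagSum_eq_add m Y (V + 1)]
    exact le_add_of_nonneg_right (Finset.sum_nonneg fun k _ => hG0 Y k)
  have hmono : Monotone P := by
    refine monotone_nat_of_le_succ fun V => le_of_tendsto_of_tendsto' (hlim V) (hlim (V + 1)) ?_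
    refine fun Y => Finset.sum_le_sum_of_subset_of_nonneg (Finset.Ioc_subset_Ioc_left ?_)
      fun k _ _ => hG0 Y k
    exact Nat.div_le_div_left (Nat.le_succ _) (Nat.succ_pos _)
  have hPle : ∀ V, P V ≤ C * Real.sqrt (psi m) * |ε 1| := fun V =>
    le_of_tendsto' (hlim V) fun Y => (hle V Y).trans (hDle Y)
  have hP0 : ∀ V, 0 ≤ P V := fun V =>
    ge_of_tendsto' (hlim V) fun Y => Finset.sum_nonneg fun k _ => hG0 Y k
  set a : ℕ → ℝ := fun j => Bconst * (Real.log (1 + 1 / (j : ℝ)) * alphaSum m j) with ha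
  have hPa : ∀ V, P V = ∑ i ∈ range V, a (i + 1) := by
    intro V
    simp only [hP, ha, ← Finset.mul_sum]
    congr 1
    rw [Finset.range_eq_Ico, Finset.sum_Ico_add' (fun j : ℕ =>
      Real.log (1 + 1 / (j : ℝ)) * alphaSum m j) 0 V 1]
    rfl
  have ha0 : ∀ i, 0 ≤ a (i + 1) := fun i => by
    have := hmono i.le_succ
    rw [hPa, hPa, Finset.sum_range_succ] at this
    linarith
  have hsum : Summable fun i => a (i + 1) :=
    summable_of_sum_range_le ha0 fun V => (hPa V).symm.le.trans (hPle V)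
  have hts : Bconst * ∑' j : ℕ+, Real.log (1 + 1 / (j : ℝ)) * alphaSum m j =
      ∑' i, a (i + 1) := by
    rw [← tsum_mul_left]
    exact tsum_pnat_eq_tsum_succ (f := a)
  have hPlim : Tendsto P atTop (nhds (∑' i, a (i + 1))) := by
    rw [funext hPa]
    exact hsum.hasSum.tendsto_sum_nat
  rw [hts]
  have hL0 : 0 ≤ ∑' i, a (i + 1) := tsum_nonneg ha0
  refine ⟨?_, ?_⟩
  · rw [Metric.tendsto_atTop]
    intro δ hδ
    have hε' : Tendsto (fun V => C * Real.sqrt (psi m) * ε (V + 1)) atTop (nhds 0) := by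
      simpa using ((tendsto_add_atTop_iff_nat 1).2 hε).const_mul (C * Real.sqrt (psi m))
    obtain ⟨V, hV1, hV2⟩ := ((hε'.eventually_lt_const (show 0 < δ / 3 by positivity)).and
      (hPlim.eventually_const_lt (show ∑' i, a (i + 1) - δ / 3 < _ by linarith))).exists
    have hV3 : P V ≤ ∑' i, a (i + 1) := hmono.ge_of_tendsto hPlim V
    obtain ⟨N, hN⟩ := Metric.tendsto_atTop.1 (hlim V) (δ / 3) (by positivity)
    refine ⟨N, fun Y hY => ?_⟩
    have h1 := hN Y hY
    have h2 := hle V Y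
    have h3 := diagSum_eq_add m Y (V + 1)
    have h4 := htail m (V + 1) Y hm (Nat.succ_pos V)
    rw [Real.dist_eq, abs_lt] at h1 ⊢
    simp only [hG] at h1 h2
    constructor <;> linarith
  · rw [abs_of_nonneg hL0]
    refine (le_of_tendsto' hPlim hPle).trans ?_
    nlinarith [mul_nonneg hC.le hpsi]

theorem stmt14 :
    (∀ m : ℕ, 1 ≤ m →
      Tendsto (fun y : ℝ => T y m) atTop
        (nhds ((6 * Bconst / (Real.pi ^ 2 * (psi m : ℝ))) *
          ∑' j : ℕ+, Real.log (1 + 1 / (j : ℝ)) *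
            ∑ d ∈ Finset.Icc 1 (j : ℕ), ∑ t ∈ Finset.Icc 1 (j : ℕ),
              alpha (d * t * m) * (ArithmeticFunction.moebius d : ℝ) *
                (ArithmeticFunction.moebius t : ℝ) / ((psiM m d : ℝ) * (psiM m t : ℝ))))) ∧
    ∃ C > (0 : ℝ), ∀ m : ℕ, 1 ≤ m →
      |(6 * Bconst / (Real.pi ^ 2 * (psi m : ℝ))) *
          ∑' j : ℕ+, Real.log (1 + 1 / (j : ℝ)) *
            ∑ d ∈ Finset.Icc 1 (j : ℕ), ∑ t ∈ Finset.Icc 1 (j : ℕ),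
              alpha (d * t * m) * (ArithmeticFunction.moebius d : ℝ) *
                (ArithmeticFunction.moebius t : ℝ) / ((psiM m d : ℝ) * (psiM m t : ℝ))| ≤
        C / Real.sqrt (psi m) := by
  obtain ⟨K, hK, h⟩ := exists_tendsto_diagSum
  have hrw : ∀ m : ℕ, (6 * Bconst / (Real.pi ^ 2 * (psi m : ℝ))) *
      ∑' j : ℕ+, Real.log (1 + 1 / (j : ℝ)) * alphaSum m j =
      6 / (Real.pi ^ 2 * (psi m : ℝ)) *
        (Bconst * ∑' j : ℕ+, Real.log (1 + 1 / (j : ℝ)) * alphaSum m j) := fun m => by ring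
  refine ⟨fun m hm => ?_, 6 / Real.pi ^ 2 * K, by positivity, fun m hm => ?_⟩
  · change Tendsto _ _ (nhds ((6 * Bconst / (Real.pi ^ 2 * (psi m : ℝ))) *
      ∑' j : ℕ+, Real.log (1 + 1 / (j : ℝ)) * alphaSum m j))
    rw [hrw, funext fun y : ℝ => T_eq_diagSum y (Nat.one_le_iff_ne_zero.1 hm)]
    exact (((h m (Nat.one_le_iff_ne_zero.1 hm)).1.comp tendsto_nat_floor_atTop).const_mul _)
  · change |(6 * Bconst / (Real.pi ^ 2 * (psi m : ℝ))) *
      ∑' j : ℕ+, Real.log (1 + 1 / (j : ℝ)) * alphaSum m j| ≤ _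
    have hψ : (0 : ℝ) < psi m := by exact_mod_cast psi_pos m
    have hs : 0 < Real.sqrt (psi m) := Real.sqrt_pos.2 hψ
    rw [hrw, abs_mul, abs_of_pos (by positivity)]
    refine (mul_le_mul_of_nonneg_left (h m (Nat.one_le_iff_ne_zero.1 hm)).2
      (by positivity)).trans_eq ?_
    rw [eq_div_iff hs.ne']
    calc
      _ = 6 / (Real.pi ^ 2 * (psi m : ℝ)) * K * (Real.sqrt (psi m) * Real.sqrt (psi m)) := by ring
      _ = _ := by
        rw [Real.mul_self_sqrt hψ.le]
        field_simp
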